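/- arXiv:2509.14135 — 3 statements merged into one kernel-verified Lean document; each statement's English description precedes it below -/
import Mathlib

section
/- Let G be a connected (P2∪P4, paw)-free simple graph. Then at least one of the following holds: (i) G has a comparable pair, i.e., two nonadjacent vertices u, v with N(u) ⊆ N(v); (ii) G is a complete graph; (iii) G contains the Grötzsch graph F1 as an induced subgraph, G is isomorphic to an induced subgraph of the Clebsch graph F2, and χ(G) = 4; (iv) χ(G) ≤ 3. -/
open SimpleGraph

/-- `H` is (isomorphic to) an induced subgraph of `G`. -/
def ContainsInduced {α β : Type*} (H : SimpleGraph α) (G : SimpleGraph β) : Prop :=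
  ∃ f : α ↪ β, ∀ a b : α, G.Adj (f a) (f b) ↔ H.Adj a b

/-- The disjoint union `P2 ∪ P4`. -/
def P2UnionP4 : SimpleGraph (Fin 6) :=
  SimpleGraph.fromEdgeSet {s(0,1), s(2,3), s(3,4), s(4,5)}

/-- The bull: a triangle with two disjoint pendant edges. -/
def BullGraph : SimpleGraph (Fin 5) :=
  SimpleGraph.fromEdgeSet {s(0,1), s(0,2), s(1,2), s(0,3), s(1,4)}

/-- The triangle `C3`. -/
def TriangleGraph : SimpleGraph (Fin 3) := ⊤

/-- The paw: a triangle with a pendant edge. -/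
def PawGraph : SimpleGraph (Fin 4) :=
  SimpleGraph.fromEdgeSet {s(0,1), s(0,2), s(1,2), s(0,3)}

/-- The diamond: `K4` minus an edge. -/
def DiamondGraph : SimpleGraph (Fin 4) :=
  SimpleGraph.fromEdgeSet {s(0,1), s(0,2), s(0,3), s(1,2), s(1,3)}

/-- The 5-cycle. -/
def Cycle5 : SimpleGraph (Fin 5) :=
  SimpleGraph.fromEdgeSet {s(0,1), s(1,2), s(2,3), s(3,4), s(0,4)}

/-- The 7-cycle. -/
def Cycle7 : SimpleGraph (Fin 7) :=
  SimpleGraph.fromEdgeSet {s(0,1), s(1,2), s(2,3), s(3,4), s(4,5), s(5,6), s(0,6)}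

/-- The Grötzsch graph `F1`: vertex `0` is `v`, vertices `1,…,5` are `w1,…,w5`,
vertices `6,…,10` are `v1,…,v5`; `v` is adjacent exactly to the `wᵢ`, the `vᵢ` form a
5-cycle, and `wᵢ` is adjacent exactly to `v`, `vᵢ` and `vᵢ₊₂` (indices mod 5). -/
def GrotzschGraph : SimpleGraph (Fin 11) :=
  SimpleGraph.fromEdgeSet
    {s(0,1), s(0,2), s(0,3), s(0,4), s(0,5),
     s(6,7), s(7,8), s(8,9), s(9,10), s(6,10),
     s(1,6), s(1,8), s(2,7), s(2,9), s(3,8), s(3,10), s(4,9), s(4,6), s(5,10), s(5,7)}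

/-- The Clebsch graph `F2`: vertices are the elements of `(ℤ/2)⁴`, two vertices adjacent
iff their difference is one of `e1, e2, e3, e4, e1+e2+e3+e4`. -/
def ClebschGraph : SimpleGraph (Fin 4 → ZMod 2) :=
  SimpleGraph.fromRel (fun x y =>
    x - y ∈ ({Pi.single 0 1, Pi.single 1 1, Pi.single 2 1, Pi.single 3 1, 1} :
      Set (Fin 4 → ZMod 2)))

/-- A graph is perfect if every induced subgraph has chromatic number equal to clique number. -/
def SimpleGraph.IsPerfect {V : Type*} (G : SimpleGraph V) : Prop :=
  ∀ S : Set V, (G.induce S).chromaticNumber = ((G.induce S).cliqueNum : ℕ∞)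

/-- A graph is perfectly divisible if each nonempty induced subgraph `H` has a partition
`(A, B)` of its vertex set such that `H[A]` is perfect and `ω(H[B]) < ω(H)`. -/
def SimpleGraph.PerfectlyDivisible {V : Type*} (G : SimpleGraph V) : Prop :=
  ∀ S : Set V, S.Nonempty → ∃ A B : Set V, A ∪ B = S ∧ A ∩ B = ∅ ∧
    (G.induce A).IsPerfect ∧ (G.induce B).cliqueNum < (G.induce S).cliqueNum

/-! ### Refuting small configurations

A core is a finite induced subgraph with vertices `0, 1, …`, given by the list of the rows of its
lower triangular adjacency matrix, written as bit masks. The remaining vertices are sorted by their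
type, the bit mask of their neighbours in the core. -/

namespace TypeRefutation

/-- The `i`-th row of the lower triangular adjacency matrix coded by `A`. -/
def row (A : List ℕ) (i : ℕ) : ℕ := A.getD i 0

/-- Adjacency in the graph coded by `A`. -/
def adj (A : List ℕ) (i j : ℕ) : Bool :=
  if j < i then (row A i).testBit j else (row A j).testBit i

/-- The `i`-th digit of `w` in base sixteen. -/
def hexDigit (w i : ℕ) : ℕ := w / 16 ^ i % 16

/-- The map sending `i` to the `i`-th hexadecimal digit of `w` embeds the graph coded by `B`
into the graph coded by `A` as an induced subgraph. -/
def embeds (B A : List ℕ) (w : ℕ) : Bool :=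
  (List.range B.length).all fun i => decide (hexDigit w i < A.length) &&
    (List.range i).all fun j =>
      ((row B i).testBit j == adj A (hexDigit w i) (hexDigit w j)) &&
      (hexDigit w i != hexDigit w j)

/-- The graph `P2 ∪ P4`. -/
def rowsP2P4 : List ℕ := [0, 1, 0, 4, 8, 16]

/-- The digits of `w` span a copy of `P2 ∪ P4` in the graph coded by `A` with a new vertex of
any type that agrees with `value` on the bits of `mask`, where `e = (mask, value, w)`. -/
def validWitness (A : List ℕ) (e : ℕ × ℕ × ℕ) : Bool :=
  embeds rowsP2P4 (A ++ [e.2.1]) e.2.2 &&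
    (List.range 6).all fun i => e.1.testBit (hexDigit e.2.2 i)

/-- A vertex of type `m` would create one of the copies of `P2 ∪ P4` listed in `W`. -/
def hits (W : List (ℕ × ℕ × ℕ)) (m : ℕ) : Bool := W.any fun e => m &&& e.1 == e.2.1

/-- Vertices of types `a` and `b` are nonadjacent, since otherwise there would be a triangle or an
edge excluded by `X`. -/
def clash (X : List (ℕ × ℕ × ℕ)) (a b : ℕ) : Bool :=
  (a &&& b != 0) || X.any fun e =>
    (a % 2 ^ e.1 == e.2.1 && b % 2 ^ e.1 == e.2.2) ||
    (a % 2 ^ e.1 == e.2.2 && b % 2 ^ e.1 == e.2.1)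

/-- A core, the types that vertices outside the core may have, and the excluded edges `(k, a, b)`
between vertices outside the first `k` core vertices and of types `a`, `b` with respect to these. -/
structure State where
  /-- Adjacency rows of the core. -/
  rows : List ℕ
  /-- Types of the vertices outside the core. -/
  types : List ℕ
  /-- Excluded edges. -/
  excl : List (ℕ × ℕ × ℕ)

/-- The state with core `A` and all types that create neither a triangle nor a copy of `P2 ∪ P4`
listed in `W`. -/
def State.root (A : List ℕ) (W : List (ℕ × ℕ × ℕ)) : State :=
  ⟨A, (List.range (2 ^ A.length)).filter fun m => !hits W m &&
    (List.range A.length).all fun i => !m.testBit i || (m % 2 ^ i &&& row A i == 0), []⟩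

/-- The state obtained by adding a vertex of type `t` to the core. -/
def State.child (S : State) (t : ℕ) (W : List (ℕ × ℕ × ℕ)) : State :=
  ⟨S.rows ++ [t],
    (S.types.flatMap fun m => m :: if clash S.excl t m then [] else [m + 2 ^ S.rows.length]).filter
      fun m => !hits W m,
    S.excl⟩

/-- Refutation trees. -/
inductive Cert where
  /-- Refute the existence of a vertex of a given type, then continue without this type. -/
  | type (t : ℕ) (W : List (ℕ × ℕ × ℕ)) (c c' : Cert)
  /-- Refute the existence of an edge between two given types, then exclude such edges. -/
  | edge (x y : ℕ) (W : List (ℕ × ℕ × ℕ)) (c c' : Cert)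
  /-- The core contains a graph which is already excluded. -/
  | known (i w : ℕ)
  /-- Two core vertices form a comparable pair. -/
  | comparable (p q : ℕ)
  /-- The graph is 3-colorable, the color of a vertex depending only on its type. -/
  | color (cK cT : ℕ) (W : List ℕ)

/-- The core vertices `p` and `q` form a comparable pair. -/
def comparableCheck (S : State) (p q : ℕ) : Bool :=
  decide (p < S.rows.length) && decide (q < S.rows.length) && (p != q) &&
  !adj S.rows p q && ((List.range S.rows.length).all fun i => !adj S.rows p i || adj S.rows q i) &&
  S.types.all fun t => !t.testBit p || t.testBit q

/-- The `i`-th color in the list coded by `c`. -/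
def colorAt (c i : ℕ) : ℕ := c / 3 ^ i % 3

/-- The coloring given by `cK` on the core and by `cT` on the types is proper. -/
def colorCheck (S : State) (cK cT : ℕ) (W : List ℕ) : Bool :=
  ((List.range S.rows.length).all fun i => (List.range i).all fun j =>
    !(row S.rows i).testBit j || colorAt cK i != colorAt cK j) &&
  (List.range S.types.length).all fun k =>
    ((List.range S.rows.length).all fun i =>
      !(S.types.getD k 0).testBit i || colorAt cT k != colorAt cK i) &&
    (List.range (k + 1)).all fun l => colorAt cT k != colorAt cT l ||
      clash S.excl (S.types.getD l 0) (S.types.getD k 0) ||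
      W.any (embeds rowsP2P4
        (S.rows ++ [S.types.getD l 0] ++ [S.types.getD k 0 + 2 ^ S.rows.length]))

/-- The certificate `c` refutes the state, given that the graphs in `Γ` are excluded. -/
def refutes (Γ : List (List ℕ)) : State → Cert → Bool
  | S, .type t W c c' => (W.all (validWitness (S.rows ++ [t])) && refutes Γ (S.child t W) c) &&
      refutes Γ ⟨S.rows, S.types.filter (· != t), S.excl⟩ c'
  | S, .edge x y W c c' =>
      (decide (x < 2 ^ S.rows.length) && decide (y < 2 ^ S.rows.length) &&
        W.all (validWitness (S.rows ++ [x] ++ [y + 2 ^ S.rows.length])) &&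
        refutes Γ ((S.child x []).child (y + 2 ^ S.rows.length) W) c) &&
      refutes Γ ⟨S.rows, S.types, (S.rows.length, x, y) :: S.excl⟩ c'
  | S, .known i w => decide (i < Γ.length) && embeds (Γ.getD i []) S.rows w
  | S, .comparable p q => comparableCheck S p q
  | S, .color cK cT W => colorCheck S cK cT W

/-- The certificate `c` refutes the core `A`, given that the graphs in `Γ` are excluded. -/
def refutesCore (Γ : List (List ℕ)) (A : List ℕ) (W : List (ℕ × ℕ × ℕ)) (c : Cert) : Bool :=
  W.all (validWitness A) && refutes Γ (.root A W) c

/-- The Grötzsch graph. -/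
def rowsGrotzsch : List ℕ := [0, 1, 1, 1, 1, 1, 18, 100, 138, 276, 616]

/-- Copies of `P2 ∪ P4` excluding types over the Grötzsch graph. -/
def witGrotzsch : List (ℕ × ℕ × ℕ) :=
  [(3521, 1, 8874672), (2726, 2, 5712305), (2390, 4, 4593842), (3242, 2, 3823537),
   (2732, 8, 5712307), (3746, 2, 10114993), (3354, 16, 1587892), (2638, 12, 3877217),
   (2418, 32, 4593845), (2710, 2, 4794289), (3610, 2, 3839153), (2776, 8, 7752115),
   (3718, 2, 11085745), (3404, 4, 6961330), (3378, 48, 4938369), (2637, 64, 9569206),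
   (3969, 1, 11110320), (3342, 4, 1587890), (2638, 72, 3891602), (3366, 36, 2841217),
   (3211, 128, 10682807), (3905, 1, 6985904), (2650, 8, 1460659), (3622, 2, 5935793),
   (2389, 256, 6554296), (3777, 1, 10119088), (3150, 4, 3826098), (3252, 16, 2579124),
   (2913, 320, 7047504), (2635, 512, 6357945), (2638, 520, 3904097), (3238, 2, 2579121),
   (3214, 10, 1784434), (2761, 576, 10184496), (2913, 576, 7051344), (2761, 640, 10188336),
   (3335, 1024, 8454842), (3009, 1, 9991856), (3366, 1028, 2860417), (2396, 20, 2836099),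
   (3473, 1152, 11237440), (3473, 1280, 11241280), (3397, 1280, 9152032)]

/-- Types over the Grötzsch graph that do not occur, together with the comparable pair that a
vertex of this type would create. -/
def rareTypes : List (ℕ × ℕ × ℕ × List (ℕ × ℕ × ℕ)) := [
  (0, 11, 0, [(6215, 2048, 6357707), (6345, 2056, 12333174), (6419, 2048, 8455371),
    (6726, 2112, 12345746), (6345, 2112, 12347184), (6285, 2048, 7472075),
    (6488, 2112, 12346499), (6726, 2560, 12358241), (6545, 2176, 12351552),
    (6425, 2048, 8586443), (7458, 3072, 12363137), (7237, 3072, 12363296),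
    (7308, 3072, 12362610), (7683, 3072, 12364048)]),
  (62, 0, 11, [(6345, 2048, 13316214), (7492, 320, 9202354), (6856, 576, 10250163),
    (7810, 640, 8166065), (7810, 1152, 8169905), (7492, 1280, 9217714)]),
  (321, 1, 11, [(6726, 2048, 13328786), (7492, 4, 9136834), (6512, 32, 9135301),
    (7809, 640, 8166064), (6484, 4, 9135298), (7809, 1152, 8169904)]),
  (356, 7, 11, [(6345, 2048, 13330224), (7196, 24, 4995762), (7489, 1, 9136832),
    (6545, 128, 12090432), (6977, 1, 7047616), (6345, 128, 13069104)]),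
  (577, 4, 11, [(6488, 2048, 13329539), (6856, 8, 10184643), (6730, 8, 10183107),
    (6754, 32, 10183109), (7553, 1152, 11303088), (7553, 1280, 11306928)]),
  (616, 10, 11, [(7683, 2048, 13343248), (6314, 2, 3889089), (6977, 1, 7051456),
    (7237, 1024, 13265696), (6849, 1, 10184640), (7683, 1024, 13277968)]),
  (641, 2, 11, [(6726, 2048, 13341281), (7810, 2, 8100545), (6824, 8, 10188227),
    (7489, 320, 9202352), (6818, 2, 10188225), (7489, 1280, 9217712)]),
  (650, 8, 11, [(6545, 2048, 13334592), (7218, 48, 5003953), (7809, 1, 8100544),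
    (6545, 256, 13138752), (6849, 1, 10188480), (6945, 256, 12160080)]),
  (1153, 5, 11, [(7458, 2048, 13346177), (7810, 2, 8104385), (7316, 16, 11236036),
    (6977, 320, 7113136), (7302, 2, 11236033), (6977, 576, 7116976)]),
  (1170, 6, 11, [(7237, 2048, 13346336), (6670, 12, 3942833), (7809, 1, 8104384),
    (6345, 64, 12020784), (7553, 1, 11237568), (7237, 64, 12217376)]),
  (1281, 3, 11, [(7308, 2048, 13345650), (7492, 4, 9152194), (7430, 4, 11239874),
    (7442, 16, 11239876), (6849, 576, 10250160), (6849, 640, 10254000)]),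
  (1300, 9, 11, [(7683, 2048, 13347088), (6294, 2, 4925377), (7553, 1, 11241408),
    (7683, 512, 12229648), (7489, 1, 9152192), (6945, 512, 13208400)])]

/-- Copies of `P2 ∪ P4` created by one vertex and by two vertices of the given type over the
Grötzsch graph. -/
def twinWitnesses : List (ℕ × List (ℕ × ℕ × ℕ) × List (ℕ × ℕ × ℕ)) := [
  (76, [(7220, 48, 5003954), (6286, 2, 3876801)], [(13364, 48, 5069506), (12430, 2, 3942353)]),
  (152, [(7194, 2, 4930241), (6682, 2, 3885505)], [(13338, 2, 4995793), (12826, 2, 3951057)]),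
  (304, [(7220, 4, 4938434), (6706, 2, 5982657)], [(13364, 4, 5003986), (12850, 2, 6048209)]),
  (546, [(6286, 12, 3942321), (7194, 24, 4995761)], [(12430, 12, 4007873), (13338, 24, 5061313)]),
  (1030, [(6682, 24, 3951025), (6706, 48, 6048177)], [(12826, 24, 4016577), (12850, 48, 6113729)])]

/-- The graph coded by `rowsCap` and a vertex joined to `1`, `4` and `5`. -/
def rowsCapExt : List ℕ := [0, 1, 2, 4, 9, 0, 42, 52, 50]

/-- Copies of `P2 ∪ P4` excluding types over `rowsCapExt`. -/
def witCapExt : List (ℕ × ℕ × ℕ) :=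
  [(717, 1, 6498192), (698, 2, 5718929), (821, 4, 5783698), (745, 1, 3561360), (811, 8, 5771411),
     (741, 1, 2578064), (683, 10, 3739765), (630, 16, 5640852), (629, 20, 2703461),
     (567, 32, 2163861), (573, 32, 275093), (629, 36, 2709056), (559, 32, 3281045),
     (725, 64, 2572438), (685, 1, 5710736), (813, 5, 598917), (715, 128, 3543191),
     (621, 1, 5649040), (813, 9, 602757), (972, 256, 6498200), (629, 68, 2712896),
     (683, 136, 3765520), (813, 257, 623922)]

/-- The refutation of `rowsCapExt`. -/
def certCapExt : Cert :=
  .edge 37 80 [(3087, 1024, 3281082), (2890, 512, 3545273), (3746, 2, 11098033),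
     (3412, 4, 6965426), (3126, 1056, 6005793), (3730, 2, 10110897), (2900, 80, 7030930),
     (3610, 2, 10109873), (2618, 514, 1807683), (2761, 136, 8074896), (2761, 192, 8086416),
     (3970, 640, 8100481), (3157, 4, 6963378), (2889, 264, 9123472), (3269, 129, 750246)] (
   .known 0 5914865861380) <|
  .edge 41 130 [(3101, 1024, 275130), (2758, 512, 7476921), (2730, 2, 3758001),
     (3130, 1056, 6005059), (3130, 40, 5977249), (3130, 48, 5981089), (3606, 16, 10097332),
     (2614, 528, 4953377), (2757, 68, 7022480), (2618, 2, 5846193), (2757, 192, 7041680),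
     (2954, 640, 8098689), (2949, 260, 9119632), (3211, 8, 7999667), (3792, 64, 10122422)] (
   .known 0 5996737626625) <|
  .edge 80 260 [(3155, 1024, 6358202), (2575, 512, 3281081), (3185, 1040, 11223141),
     (3657, 1, 11101104), (3461, 1, 9054128), (3730, 2, 11093937), (3185, 1056, 11228736),
     (3125, 48, 5980322), (3157, 80, 7028898), (3610, 2, 11092913), (3528, 1152, 8104035),
     (3880, 8, 10126771), (2860, 520, 10171013), (3409, 64, 11026614), (3235, 1152, 11236624),
     (3341, 1, 9053104), (2645, 4, 6897842), (3595, 520, 3906064), (3681, 1, 11101616)] (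
   .type 1217 [(6414, 2048, 3283147), (7330, 2, 11236801), (6189, 40, 6042288),
      (6189, 36, 6038448), (6413, 260, 9184176), (6413, 264, 9188016)] (
    .known 0 11138655290116) <|
   .color 51095 32685 [2163915, 12360208, 12345716, 12358689]) <|
  .edge 130 264 [(3095, 1024, 2163898), (2589, 512, 275129), (3185, 1040, 11223141),
     (3401, 1, 9057968), (3717, 1, 11104944), (3115, 34, 5968035), (2618, 48, 5981073),
     (3606, 16, 11080372), (3524, 1088, 7055474), (3876, 4, 10126770), (2860, 516, 10167173),
     (3211, 130, 8065187), (3409, 64, 11026614), (3341, 1, 9056944), (3605, 516, 2857536),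
     (2699, 8, 7934131), (3745, 1, 11105712)] (
   .type 1217 [(6414, 2048, 3283147), (7330, 2, 11236801), (6189, 40, 6042288),
      (6189, 36, 6038448), (6413, 260, 9184176), (6413, 264, 9188016)] (
    .known 0 11220528038401) <|
   .color 49619 55797 [2163915, 6358219, 12357955, 12350561]) <|
  .edge 41 260 [(3155, 1024, 6358202), (2758, 512, 7476921), (2730, 2, 3758001),
     (3461, 1, 9054128), (3185, 1056, 11228736), (3125, 48, 5980322), (3157, 80, 7028898),
     (2757, 68, 7022480), (2618, 2, 5846193), (3969, 128, 9081015), (3235, 1152, 11236624),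
     (2954, 640, 8098689), (3341, 1, 9053104), (2949, 260, 9119632), (2757, 192, 7041680)] (
   .type 37 [(6474, 2048, 3545291), (6932, 528, 10242226), (6345, 136, 8140464),
      (6473, 264, 9189040), (6345, 192, 8151984)] (
    .known 0 6117249430290) <|
   .edge 264 1217 [(12558, 4096, 3283164), (10263, 2048, 2163931), (13474, 2, 11302353),
      (12333, 40, 6107840), (14858, 2, 13318609), (12333, 36, 6104000), (14628, 4, 13338066),
      (10509, 1, 9122512), (12557, 260, 9249728), (12557, 264, 9253568)] (
    .known 0 13200761906211) <|
   .color 122855 2409837 [2163915, 12343585, 12342848, 12343346, 12362304]) <|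
  .edge 193 260 [(3155, 1024, 6358202), (2830, 512, 3283129), (3746, 2, 11105713),
     (3185, 1040, 11223141), (3461, 1, 9054128), (2605, 40, 5976720), (3125, 48, 5980322),
     (2605, 36, 5972880), (3157, 80, 7028898), (3610, 1026, 1812803), (3880, 8, 10126771),
     (3409, 64, 11026614), (3235, 1152, 11236624), (3341, 1, 9053104), (2829, 260, 9118608),
     (2829, 264, 9122448)] (
   .type 776 [(6167, 2048, 2163915), (6473, 1, 9123520), (6794, 2, 3905473), (6948, 4, 10192322),
      (6682, 2, 10171585), (6413, 1, 9122496)] (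
    .known 0 10386148795416) <|
   .color 47314 4299753 [2163915, 3545291, 12329872, 12331584, 12345716]) <|
  .type 37 [(1866, 512, 3545257), (1652, 16, 2709156), (1876, 80, 6965394), (1594, 514, 1742147),
     (1737, 136, 8009360), (1737, 192, 8020880), (1876, 576, 6984324), (1865, 264, 9057936)] (
   .type 41 [(3270, 1024, 7476922), (3242, 2, 3823537), (3269, 68, 7022496), (3130, 2, 5911729),
      (3461, 260, 9119648), (3269, 192, 7041696)] (
    .known 0 288326461285) <|
   .color 38669 611619 [2163898, 3410362, 11244164, 11236449]) <|
  .color 453 80539209 [2163881, 10109029, 10114624, 10115122, 10114832, 11105552]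

/-- A 5-cycle `0, …, 4` and a path `6, 5, 7`, with `6` joined to `1` and `3`, and `7` to
`2` and `4`. -/
def rowsCap : List ℕ := [0, 1, 2, 4, 9, 0, 42, 52]

/-- Copies of `P2 ∪ P4` excluding types over `rowsCap`. -/
def witCap : List (ℕ × ℕ × ℕ) :=
  [(461, 1, 6498176), (442, 2, 5718913), (489, 1, 3561344), (485, 1, 2578048),
     (427, 10, 3674229), (374, 16, 5640836), (373, 20, 2637925), (311, 32, 2163845),
     (317, 32, 275077), (373, 36, 2643520), (303, 32, 3281029), (469, 64, 2572422),
     (429, 1, 5710720), (373, 68, 2647360), (459, 128, 3543175), (365, 1, 5649024),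
     (427, 136, 3699984)]

/-- The refutation of `rowsCap`. -/
def certCap : Cert :=
  .type 50 [(972, 256, 6498200), (821, 4, 5783698), (811, 8, 5771411), (813, 5, 598917),
     (813, 9, 602757), (813, 257, 623922)] (
   .known 1 36344967696) <|
  .type 192 [(931, 256, 9991440), (969, 1, 7889808), (965, 1, 6845072), (881, 32, 8804672),
     (931, 32, 8870160)] (
   .comparable 5 8) <|
  .type 193 [(798, 256, 4399512), (853, 4, 6816914), (907, 8, 7864723), (813, 40, 5845632),
     (813, 36, 5841792)] (
   .known 1 35450725221) <|
  .edge 37 80 [(1551, 512, 3281065), (1496, 256, 7616168), (1621, 4, 6897826),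
     (1323, 8, 5767587), (1954, 2, 9983905), (1590, 36, 5906836), (1590, 544, 5936161),
     (1938, 2, 8996769), (1334, 16, 5775780), (1818, 2, 8995745), (1338, 258, 1738051),
     (1733, 129, 684694), (1481, 136, 8009344)] (
   .known 1 40054040384) <|
  .color 1307 2481101 [2163864, 6358168, 8994917, 275096, 276120]

/-- A 5-cycle and an isolated vertex. -/
def rowsCycleFive : List ℕ := [0, 1, 2, 4, 9, 0]

/-- Copies of `P2 ∪ P4` excluding types over `rowsCycleFive`. -/
def witCycleFive : List (ℕ × ℕ × ℕ) :=
  [(119, 32, 2163813), (126, 32, 4399461), (125, 32, 275045), (123, 32, 3408229),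
     (111, 32, 3280997)]

/-- The refutation of `rowsCycleFive`. -/
def certCycleFive : Cert :=
  .edge 1 2 [(461, 128, 8871986), (474, 64, 1534019), (461, 1, 7735346), (474, 2, 6756419),
     (469, 4, 7734402), (476, 4, 4401270), (470, 16, 6754948), (476, 16, 8663670),
     (442, 160, 5796163), (442, 40, 5780593), (365, 40, 5780064), (365, 96, 5791794),
     (365, 36, 5776224), (442, 48, 5784433)] (
   .comparable 5 3) <|
  .edge 1 16 [(461, 128, 8871986), (470, 64, 4679713), (461, 1, 7735346), (474, 2, 6767489),
     (459, 8, 7733635), (462, 8, 8593782), (470, 16, 6768673), (462, 2, 3283062),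
     (438, 36, 5775732), (438, 160, 5796897), (365, 40, 5780064), (438, 34, 5771892),
     (365, 96, 5791794), (365, 36, 5776224)] (
   .comparable 5 2) <|
  .edge 4 8 [(469, 128, 8872512), (459, 64, 3631120), (474, 2, 6763649), (469, 4, 7743552),
     (459, 8, 6764560), (467, 2, 8455286), (470, 16, 7741828), (467, 16, 8651126),
     (427, 33, 5767539), (373, 33, 5768290), (373, 96, 5792320), (373, 48, 5783650),
     (427, 34, 5771379), (427, 160, 5796624)] (
   .comparable 5 0) <|
  .type 5 [(245, 32, 2491509), (237, 32, 402293)] (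
   .edge 9 64 [(791, 256, 2163864), (798, 256, 4399512), (922, 2, 8860817), (858, 258, 1672771),
      (858, 66, 1665091), (917, 4, 8848530), (795, 256, 3408280), (843, 8, 8782227),
      (858, 10, 1651846), (854, 16, 8790420), (918, 272, 4818721), (918, 144, 4814881),
      (970, 2, 6845329), (858, 18, 1655686), (918, 18, 4788871), (918, 20, 4792711),
      (952, 32, 8860821), (888, 288, 5867075), (870, 32, 8790421), (934, 288, 5867297),
      (945, 32, 8848533), (683, 32, 3604885), (867, 32, 8782229)] (
    .comparable 5 1) <|
   .edge 10 64 [(791, 256, 2163864), (725, 128, 2491543), (730, 64, 1520790), (909, 1, 8860304),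
      (798, 256, 4399512), (858, 258, 1672771), (858, 66, 1665091), (917, 260, 2721600),
      (917, 132, 2717760), (917, 5, 2688135), (843, 8, 8782227), (858, 10, 1651846),
      (726, 16, 6428564), (854, 16, 8790420), (918, 16, 8852116), (980, 16, 7889556),
      (978, 16, 6844820), (888, 288, 5867075), (742, 32, 6428565), (745, 96, 5857395),
      (739, 32, 7407253), (745, 160, 5862240)] (
    .known 2 1988305156) <|
   .edge 18 64 [(791, 256, 2163864), (717, 128, 402327), (730, 64, 1524630), (909, 257, 624434),
      (909, 129, 620594), (858, 258, 1672771), (858, 66, 1665091), (917, 4, 8863890),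
      (795, 256, 3408280), (909, 5, 598919), (715, 8, 7407251), (843, 8, 8782227),
      (907, 8, 8851603), (970, 8, 6844819), (969, 8, 7889043), (854, 16, 8790420),
      (783, 256, 3281048), (858, 18, 1655686), (888, 288, 5867075), (742, 32, 6428565),
      (756, 160, 5862498), (756, 96, 5857908), (739, 32, 7407253)] (
    .known 2 1988362531) <|
   .edge 37 72 [(791, 256, 2163864), (760, 192, 6911299), (858, 2, 6829201), (922, 2, 7877777),
      (683, 8, 5702035), (994, 2, 6845841), (698, 10, 1651829), (854, 16, 8790420),
      (694, 16, 5710228), (756, 16, 5711508), (938, 2, 3700113), (1008, 16, 6845844),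
      (811, 33, 5833091), (870, 32, 8790421), (811, 34, 5836931), (867, 32, 8782229),
      (811, 288, 5866256)] (
    .color 7219 1227000815 [2163881, 3409577, 10105973, 8790441, 10109813]) <|
   .edge 37 80 [(783, 256, 3281048), (760, 192, 6911299), (858, 2, 6833041), (922, 2, 7881617),
      (843, 8, 8782227), (683, 8, 5702035), (1000, 8, 6845843), (745, 8, 5703315),
      (946, 2, 4748689), (694, 16, 5710228), (994, 2, 6845841), (698, 18, 1655669),
      (822, 36, 5841284), (870, 32, 8790421), (822, 288, 5866529), (822, 34, 5837444),
      (867, 32, 8782229)] (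
    .color 7111 495008000 [2163881, 4399529, 3409577, 10109813, 8782249, 10111009, 10105973]) <|
   .edge 41 64 [(934, 256, 9991457), (742, 64, 9838965), (698, 2, 5715089), (858, 66, 1665091),
      (693, 4, 5702802), (843, 8, 8782227), (994, 2, 6845841), (854, 16, 8790420),
      (694, 144, 4814113), (756, 144, 4814178), (694, 18, 4788853), (1008, 16, 6845844),
      (694, 20, 4792693), (888, 288, 5867075), (934, 32, 8870177), (918, 18, 4788871),
      (867, 32, 8782229)] (
    .color 3786 36524872 [2163881, 4399529, 10105990, 10097269, 10114849, 10097287]) <|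
   .type 64 [(407, 128, 2163847), (414, 128, 4399495), (474, 130, 1603139), (474, 66, 1599299),
      (411, 128, 3408263), (459, 8, 7733635), (474, 10, 1586294), (470, 16, 7741828),
      (399, 128, 3281031), (474, 18, 1590134), (504, 160, 5797443), (486, 32, 7741829),
      (483, 32, 7733637)] (
    .comparable 7 2) <|
   .type 72 [(407, 128, 2163847), (474, 2, 6763649), (470, 16, 7741828), (427, 33, 5767539),
      (486, 32, 7741829), (427, 34, 5771379), (483, 32, 7733637), (427, 160, 5796624)] (
    .comparable 5 1) <|
   .type 80 [(399, 128, 3281031), (474, 2, 6767489), (459, 8, 7733635), (438, 36, 5775732),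
      (486, 32, 7741829), (438, 160, 5796897), (438, 34, 5771892), (483, 32, 7733637)] (
    .comparable 5 1) <|
   .comparable 6 1) <|
  .type 9 [(237, 32, 406133), (235, 32, 3539317)] (
   .edge 18 64 [(791, 256, 2163864), (717, 128, 406167), (726, 64, 4657814), (909, 257, 624434),
      (909, 129, 620594), (858, 2, 8795281), (797, 256, 275096), (725, 4, 7603858),
      (853, 4, 8782994), (917, 4, 8863890), (907, 8, 8851603), (909, 9, 602759),
      (854, 272, 4818465), (854, 80, 4810785), (854, 18, 4788870), (965, 4, 7889042),
      (980, 4, 6845586), (760, 32, 7616149), (746, 160, 5861731), (870, 288, 5867041),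
      (753, 32, 7603861), (746, 96, 5858161)] (
    .known 2 1736654866) <|
   .edge 20 64 [(791, 256, 2163864), (715, 128, 3539351), (726, 64, 4661654), (909, 1, 8856464),
      (798, 256, 4399512), (730, 2, 7616145), (858, 2, 8795281), (922, 2, 8864657),
      (853, 4, 8782994), (795, 256, 3408280), (907, 136, 3766288), (907, 9, 3735943),
      (978, 2, 6845585), (854, 272, 4818465), (854, 80, 4810785), (970, 2, 7889809),
      (854, 20, 4792710), (760, 32, 7616149), (870, 288, 5867041), (753, 32, 7603861),
      (741, 160, 5861984), (741, 96, 5857394)] (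
    .known 2 1988244481) <|
   .edge 37 64 [(952, 256, 9991491), (760, 64, 9843829), (858, 2, 8795281), (698, 130, 1668419),
      (853, 4, 8782994), (683, 8, 5702035), (994, 2, 6845841), (698, 10, 1651829),
      (694, 16, 5710228), (854, 80, 4810785), (746, 130, 1668451), (698, 18, 1655669),
      (1008, 16, 6845844), (952, 32, 8870211), (870, 288, 5867041), (881, 32, 8782997),
      (922, 18, 1655687)] (
    .color 3828 9277201 [2163881, 4399529, 10109813, 10114883, 10109831]) <|
   .edge 41 66 [(797, 256, 275096), (742, 192, 6911265), (698, 2, 5715089), (853, 4, 8782994),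
      (693, 4, 5702802), (854, 16, 6820500), (918, 16, 7869076), (746, 2, 5715601),
      (694, 18, 4788853), (741, 4, 5703314), (946, 16, 1602964), (888, 32, 8795285),
      (826, 288, 5865795), (826, 40, 5846145), (881, 32, 8782997), (826, 48, 5849985)] (
    .color 7093 452611709 [2163881, 3283113, 10097269, 2164393, 8783017, 10098755, 11080309]) <|
   .edge 41 68 [(795, 256, 3408280), (742, 192, 6911265), (858, 2, 8795281), (698, 2, 5715089),
      (693, 4, 5702802), (994, 2, 6845841), (854, 16, 6824340), (918, 16, 7872916),
      (746, 2, 5715601), (948, 16, 2651540), (741, 4, 5703314), (694, 20, 4792693),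
      (888, 32, 8795285), (821, 33, 5833858), (881, 32, 8782997), (821, 288, 5866048),
      (821, 48, 5849218)] (
    .color 7081 150757460 [2163881, 2164393, 10102848, 10097269]) <|
   .type 64 [(407, 128, 2163847), (414, 128, 4399495), (474, 2, 7746689), (413, 128, 275079),
      (469, 4, 7734402), (411, 128, 3408263), (470, 144, 4748833), (470, 80, 4744993),
      (470, 18, 4723318), (470, 20, 4727158), (504, 32, 7746693), (486, 160, 5797409),
      (497, 32, 7734405)] (
    .comparable 7 3) <|
   .type 66 [(413, 128, 275079), (469, 4, 7734402), (470, 16, 6754948), (504, 32, 7746693),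
      (442, 160, 5796163), (442, 40, 5780593), (497, 32, 7734405), (442, 48, 5784433)] (
    .comparable 5 1) <|
   .type 68 [(411, 128, 3408263), (474, 2, 7746689), (470, 16, 6758788), (504, 32, 7746693),
      (437, 33, 5768306), (497, 32, 7734405), (437, 160, 5796416), (437, 48, 5783666)] (
    .comparable 5 2) <|
   .comparable 6 4) <|
  .type 10 [(250, 32, 1455221), (235, 32, 3543157)] (
   .edge 1 8 [(791, 256, 2163864), (670, 128, 4399511), (717, 64, 9843312), (966, 64, 9835143),
      (922, 2, 7877777), (717, 4, 6498672), (730, 128, 1455255), (917, 4, 8848530),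
      (918, 272, 4818721), (918, 18, 4788871), (978, 144, 4814945), (918, 20, 4792711),
      (811, 33, 5833091), (685, 40, 5845616), (685, 160, 5861426), (811, 288, 5866256)] (
    .comparable 2 6) <|
   .edge 20 65 [(798, 256, 4399512), (715, 128, 3543191), (725, 64, 2572438), (717, 1, 6498192),
      (922, 2, 8864657), (853, 4, 6816914), (907, 8, 7864723), (854, 16, 8786580),
      (754, 96, 5857652), (742, 32, 7476885), (754, 160, 5862497), (813, 40, 5845632),
      (754, 34, 5838452), (748, 32, 6498197), (813, 36, 5841792)] (
    .comparable 5 0) <|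
   .edge 41 64 [(934, 256, 9991457), (742, 64, 9835125), (845, 1, 8794768), (698, 2, 5715089),
      (693, 4, 5702802), (853, 68, 2713664), (854, 16, 8786580), (694, 144, 4814113),
      (1008, 16, 6845844), (694, 18, 4788853), (742, 4, 9574005), (754, 144, 4814177),
      (694, 20, 4792693), (934, 32, 8870177), (881, 288, 5867072), (876, 32, 8794773),
      (918, 20, 4792711)] (
    .color 3746 3975535 [2163881, 10101127, 10114849, 10097287]) <|
   .type 64 [(407, 128, 2163847), (461, 1, 7746176), (414, 128, 4399495), (413, 128, 275079),
      (469, 132, 2651712), (469, 68, 2647872), (470, 16, 7737988), (399, 128, 3281031),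
      (469, 20, 2637942), (486, 32, 7737989), (497, 160, 5797440), (492, 32, 7746181)] (
    .color 5052 45356858 [2163864, 6358168, 9987904]) <|
   .type 65 [(414, 128, 4399495), (469, 4, 6751362), (470, 16, 7737988), (486, 32, 7737989),
      (429, 40, 5780080), (492, 32, 7746181), (429, 160, 5795890), (429, 36, 5776240)] (
    .color 2865 20791502 [2163864, 8980274, 6358168, 1455256]) <|
   .type 80 [(399, 128, 3281031), (461, 1, 7746176), (469, 4, 6766722), (438, 36, 5775732),
      (486, 32, 7737989), (438, 160, 5796897), (438, 34, 5771892), (492, 32, 7746181)] (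
    .color 1387 4971038 [2163864, 6358168, 8986996]) <|
   .comparable 6 2) <|
  .type 18 [(250, 32, 1459061), (246, 32, 4592245)] (
   .type 68 [(411, 128, 3408263), (461, 1, 6759296), (459, 8, 7737475), (437, 33, 5768306),
      (497, 32, 7749765), (437, 160, 5796416), (437, 48, 5783666), (483, 32, 7737477)] (
    .color 2775 4793171 [2163864, 3282584, 8979570, 4401048, 9007680, 8988480]) <|
   .type 72 [(407, 128, 2163847), (461, 1, 6763136), (469, 4, 7749762), (427, 33, 5767539),
      (497, 32, 7749765), (427, 34, 5771379), (483, 32, 7737477), (427, 160, 5796624)] (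
    .color 1261 16737833 [2163864, 3282584, 8978803, 8982643, 275096]) <|
   .edge 42 64 [(945, 256, 9991488), (753, 64, 9846901), (685, 1, 5714576), (845, 65, 616498),
      (853, 4, 8798354), (843, 8, 8786067), (694, 16, 5706388), (996, 4, 6845842),
      (693, 20, 2703477), (917, 5, 2688135), (945, 32, 8870208), (876, 288, 5867058),
      (867, 32, 8786069)] (
    .color 8294 1429851 [2163881, 275113, 10093703, 10114880]) <|
   .type 64 [(407, 128, 2163847), (461, 129, 554546), (461, 65, 550706), (413, 128, 275079),
      (469, 4, 7749762), (411, 128, 3408263), (459, 8, 7737475), (399, 128, 3281031),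
      (497, 32, 7749765), (492, 160, 5797426), (483, 32, 7737477)] (
    .comparable 7 4) <|
   .comparable 6 0) <|
  .type 37 [(250, 66, 1533251), (235, 8, 5636467), (246, 16, 5644660)] (
   .type 42 [(469, 128, 2491527), (474, 64, 1520774), (429, 1, 5714560), (437, 132, 2651456),
      (438, 16, 5706372), (498, 16, 1529476)] (
    .known 2 1985159428) <|
   .type 50 [(461, 128, 402311), (474, 64, 1524614), (429, 129, 554290), (437, 4, 5718146),
      (427, 8, 5705859)] (
    .known 2 1985216803) <|
   .edge 2 72 [(791, 256, 2163864), (729, 128, 3409559), (760, 192, 7955779), (909, 1, 7877264),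
      (858, 2, 6829201), (730, 72, 6894705), (730, 80, 6898545), (1008, 16, 7890324),
      (760, 144, 7947109), (811, 33, 5833091), (698, 40, 5846129), (698, 48, 5849969)] (
    .known 2 2171807236) <|
   .edge 2 80 [(783, 256, 3281048), (729, 128, 3409559), (760, 192, 7955779), (858, 2, 6833041),
      (917, 4, 7880850), (730, 72, 6894705), (730, 80, 6898545), (760, 144, 7947109),
      (822, 36, 5841284), (698, 40, 5846129), (698, 48, 5849969)] (
    .known 2 2171864611) <|
   .color 307 123637 [2163847, 3409543, 3281031, 8873283]) <|
  .type 41 [(250, 2, 5649521), (245, 4, 5637234), (246, 80, 4678945), (246, 20, 4661605)] (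
   .type 50 [(461, 128, 406151), (470, 64, 4657798), (429, 129, 554290), (437, 4, 5718146),
      (427, 8, 5705859)] (
    .known 2 1733509138) <|
   .type 52 [(459, 128, 3539335), (470, 64, 4661638), (429, 1, 5710720), (442, 2, 5718913),
      (427, 136, 3699984)] (
    .known 2 1985098753) <|
   .comparable 5 3) <|
  .type 42 [(237, 1, 5649008), (245, 68, 2581824), (246, 16, 5640820), (245, 20, 2572389)] (
   .type 52 [(459, 128, 3543175), (469, 64, 2572422), (429, 1, 5710720), (442, 2, 5718913),
      (427, 136, 3699984)] (
    .known 2 1985229328) <|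
   .comparable 5 1) <|
  .comparable 5 4

/-- A 7-cycle and an isolated vertex. -/
def rowsCycleSeven : List ℕ := [0, 1, 2, 4, 8, 16, 33, 0]

/-- Copies of `P2 ∪ P4` excluding types over `rowsCycleSeven`. -/
def witCycleSeven : List (ℕ × ℕ × ℕ) :=
  [(317, 1, 5517952), (378, 2, 6636417), (349, 4, 4401248), (315, 8, 5519376), (311, 1, 2164820),
     (349, 16, 8663648), (374, 16, 6637601), (315, 32, 8733456), (365, 32, 415794),
     (374, 64, 8803361), (347, 64, 8782147), (455, 128, 2164359), (411, 129, 7864643),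
     (461, 136, 7877216), (411, 144, 7881488), (486, 132, 7872869), (438, 160, 7885857),
     (461, 192, 7888946), (435, 130, 7868500)]

/-- The refutation of `rowsCycleSeven`. -/
def certCycleSeven : Cert :=
  .comparable 7 0

set_option maxRecDepth 100000 in
lemma refutesCore_CapExt : refutesCore [rowsGrotzsch] rowsCapExt witCapExt certCapExt = true := by
  decide +kernel

set_option maxRecDepth 100000 in
lemma refutesCore_Cap : refutesCore [rowsGrotzsch, rowsCapExt] rowsCap witCap certCap = true := by
  decide +kernel

set_option maxRecDepth 100000 in
lemma refutesCore_CycleFive :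
    refutesCore [rowsGrotzsch, rowsCapExt, rowsCap] rowsCycleFive
      witCycleFive certCycleFive = true := by
  decide +kernel

set_option maxRecDepth 100000 in
lemma refutesCore_CycleSeven :
    refutesCore [rowsGrotzsch, rowsCapExt, rowsCap, rowsCycleFive] rowsCycleSeven
      witCycleSeven certCycleSeven = true := by
  decide +kernel

variable {V : Type*} {G : SimpleGraph V}

/-- The vertices `f 0, f 1, …` induce the graph coded by `A`. -/
structure IsCore (G : SimpleGraph V) (A : List ℕ) (f : ℕ → V) : Prop where
  adj_iff : ∀ i < A.length, ∀ j < i, (row A i).testBit j = true ↔ G.Adj (f i) (f j)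
  ne : ∀ i < A.length, ∀ j < i, f i ≠ f j

/-- The vertex `x` has type `m` with respect to `f 0, …, f (n - 1)`. -/
def HasType (G : SimpleGraph V) (f : ℕ → V) (n m : ℕ) (x : V) : Prop :=
  ∀ i < n, m.testBit i = true ↔ G.Adj x (f i)

/-- No two adjacent vertices `x`, `y` are as described by the excluded edge `e`. -/
def IsExcluded (G : SimpleGraph V) (f : ℕ → V) (e : ℕ × ℕ × ℕ) : Prop :=
  ∀ x y, (∀ i < e.1, x ≠ f i) → (∀ i < e.1, y ≠ f i) →
    HasType G f e.1 e.2.1 x → HasType G f e.1 e.2.2 y → ¬ G.Adj x y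

/-- The graph is as described by the state `S`, with core vertices `f 0, f 1, …`. -/
structure Compat (G : SimpleGraph V) (S : State) (f : ℕ → V) : Prop where
  core : IsCore G S.rows f
  types : ∀ x, (∀ i < S.rows.length, x ≠ f i) →
    ∃ m ∈ S.types, m < 2 ^ S.rows.length ∧ HasType G f S.rows.length m x
  excl : ∀ e ∈ S.excl, e.1 ≤ S.rows.length ∧ IsExcluded G f e

lemma IsCore.injective {A : List ℕ} {f : ℕ → V} (h : IsCore G A f) {i j : ℕ} (hi : i < A.length)
    (hj : j < A.length) (hij : i ≠ j) : f i ≠ f j := by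
  rcases lt_or_gt_of_ne hij with h' | h'
  · exact (h.ne j hj i h').symm
  · exact h.ne i hi j h'

lemma IsCore.adj_eq {A : List ℕ} {f : ℕ → V} (h : IsCore G A f) {i j : ℕ} (hi : i < A.length)
    (hj : j < A.length) (hij : i ≠ j) : adj A i j = true ↔ G.Adj (f i) (f j) := by
  unfold adj
  split_ifs with h'
  · exact h.adj_iff i hi j h'
  · rw [h.adj_iff j hj i (by omega), G.adj_comm]

lemma IsCore.of_embeds {A B : List ℕ} {f : ℕ → V} {w : ℕ} (h : IsCore G A f)
    (hw : embeds B A w = true) : IsCore G B fun i => f (hexDigit w i) := by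
  simp only [embeds, List.all_eq_true, List.mem_range, Bool.and_eq_true, decide_eq_true_eq,
    beq_iff_eq, bne_iff_ne] at hw
  constructor
  · intro i hi j hj
    have hij := (hw i hi).2 j hj
    rw [hij.1, h.adj_eq (hw i hi).1 (hw j (hj.trans hi)).1 hij.2]
  · intro i hi j hj
    exact h.injective (hw i hi).1 (hw j (hj.trans hi)).1 ((hw i hi).2 j hj).2

lemma HasType.congr {f g : ℕ → V} {n m : ℕ} {x : V} (h : HasType G f n m x)
    (hfg : ∀ i < n, f i = g i) : HasType G g n m x := fun i hi => hfg i hi ▸ h i hi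

lemma HasType.mod {f : ℕ → V} {n m k : ℕ} {x : V} (h : HasType G f n m x) (hk : k ≤ n) :
    HasType G f k (m % 2 ^ k) x := fun i hi => by
  rw [Nat.testBit_mod_two_pow, ← h i (hi.trans_le hk)]
  simp [hi]

lemma IsExcluded.congr {f g : ℕ → V} {e : ℕ × ℕ × ℕ} (h : IsExcluded G f e)
    (hfg : ∀ i < e.1, f i = g i) : IsExcluded G g e := fun x y hx hy hxt hyt =>
  h x y (fun i hi => hfg i hi ▸ hx i hi) (fun i hi => hfg i hi ▸ hy i hi)
    (hxt.congr fun i hi => (hfg i hi).symm) (hyt.congr fun i hi => (hfg i hi).symm)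

lemma testBit_add_two_pow {m n i : ℕ} (hm : m < 2 ^ n) (hi : i ≤ n) :
    (m + 2 ^ n).testBit i = (m.testBit i || decide (i = n)) := by
  rcases hi.eq_or_lt with rfl | hi
  · rw [add_comm, Nat.testBit_two_pow_add_eq, Nat.testBit_lt_two_pow hm]
    simp
  · rw [add_comm, Nat.testBit_two_pow_add_gt hi]
    simp [hi.ne]

lemma row_append_of_lt {A : List ℕ} {t i : ℕ} (hi : i < A.length) : row (A ++ [t]) i = row A i := by
  exact List.getD_append _ _ _ _ hi

lemma row_append_length {A : List ℕ} {t : ℕ} : row (A ++ [t]) A.length = t := by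
  simp [row]

open Function in
lemma IsCore.append {A : List ℕ} {f : ℕ → V} {t : ℕ} {x : V} (h : IsCore G A f)
    (hx : ∀ i < A.length, x ≠ f i) (ht : HasType G f A.length t x) :
    IsCore G (A ++ [t]) (update f A.length x) := by
  constructor
  · intro i hi j hj
    rw [update_of_ne (a := j) (by simp at hi; omega)]
    rcases (show i ≤ A.length by simp at hi; omega).eq_or_lt with rfl | hi'
    · rw [row_append_length, update_self, ht j hj]
    · rw [row_append_of_lt hi', update_of_ne hi'.ne, h.adj_iff i hi' j hj]
  · intro i hi j hj
    rw [update_of_ne (a := j) (by simp at hi; omega)]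
    rcases (show i ≤ A.length by simp at hi; omega).eq_or_lt with rfl | hi'
    · rw [update_self]
      exact hx j hj
    · rw [update_of_ne hi'.ne]
      exact h.ne i hi' j hj

open Function in
lemma HasType.add_two_pow {f : ℕ → V} {n m : ℕ} {x y : V} (hm : m < 2 ^ n)
    (h : HasType G f n m y) (hxy : G.Adj y x) :
    HasType G (update f n x) (n + 1) (m + 2 ^ n) y := fun i hi => by
  rw [testBit_add_two_pow hm (by omega)]
  rcases (show i ≤ n by omega).eq_or_lt with rfl | hi'
  · simpa using hxy
  · rw [update_of_ne hi'.ne, ← h i hi']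
    simp [hi'.ne]

open Function in
lemma HasType.succ {f : ℕ → V} {n m : ℕ} {x y : V} (hm : m < 2 ^ n)
    (h : HasType G f n m y) (hxy : ¬ G.Adj y x) : HasType G (update f n x) (n + 1) m y :=
  fun i hi => by
  rcases (show i ≤ n by omega).eq_or_lt with rfl | hin
  · simpa [Nat.testBit_lt_two_pow hm] using hxy
  · rw [update_of_ne hin.ne, ← h i hin]

/-- The assumptions on the graph under which states are refuted. -/
structure Admissible (G : SimpleGraph V) : Prop where
  triangle_free : ∀ x y z, G.Adj x y → G.Adj x z → ¬ G.Adj y z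
  p2p4_free : ∀ f, ¬ IsCore G rowsP2P4 f
  not_comparable : ∀ x y, x ≠ y → ¬ G.Adj x y → ∃ z, G.Adj x z ∧ ¬ G.Adj y z
  not_colorable : ¬ G.Colorable 3

lemma Admissible.not_hits (hG : Admissible G) {A : List ℕ} {f : ℕ → V}
    {W : List (ℕ × ℕ × ℕ)} {m : ℕ} {x : V} (h : IsCore G A f) (hx : ∀ i < A.length, x ≠ f i)
    (hxt : HasType G f A.length m x) (hW : W.all (validWitness A) = true) : hits W m = false := by
  by_contra hh
  simp only [hits, Bool.not_eq_false, List.any_eq_true, beq_iff_eq] at hh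
  obtain ⟨⟨mask, value, w⟩, he, hmv⟩ := hh
  have hv := List.all_eq_true.1 hW _ he
  simp only [validWitness, Bool.and_eq_true, List.all_eq_true, List.mem_range] at hv hmv
  obtain ⟨hemb, hbits⟩ := hv
  have key : ∀ i < 6, value.testBit (hexDigit w i) = m.testBit (hexDigit w i) := fun i hi => by
    rw [← hmv, Nat.testBit_land, hbits i hi, Bool.and_true]
  refine hG.p2p4_free _ ((h.append hx hxt).of_embeds (w := w) ?_)
  simp only [embeds, List.all_eq_true, List.mem_range, Bool.and_eq_true, decide_eq_true_eq,
    beq_iff_eq, bne_iff_ne, List.length_append, List.length_singleton] at hemb ⊢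
  have hlen : rowsP2P4.length = 6 := rfl
  have hrow : ∀ i < 6, ∀ j < 6, (row (A ++ [value]) (hexDigit w i)).testBit (hexDigit w j) =
      (row (A ++ [m]) (hexDigit w i)).testBit (hexDigit w j) := fun i hi j hj => by
    rcases (Nat.lt_succ_iff.1 (hemb i hi).1).eq_or_lt with h' | h'
    · rw [h', row_append_length, row_append_length, key j hj]
    · rw [row_append_of_lt h', row_append_of_lt h']
  refine fun i hi => ⟨(hemb i hi).1, fun j hj => ?_⟩
  rw [hlen] at hi
  refine ⟨((hemb i hi).2 j hj).1.trans ?_, ((hemb i hi).2 j hj).2⟩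
  unfold adj
  rw [hrow i hi j (hj.trans hi), hrow j (hj.trans hi) i hi]

lemma Admissible.not_clash (hG : Admissible G) {f : ℕ → V} {X : List (ℕ × ℕ × ℕ)} {n a b : ℕ}
    {x y : V} (hX : ∀ e ∈ X, e.1 ≤ n ∧ IsExcluded G f e) (ha : a < 2 ^ n)
    (hx : ∀ i < n, x ≠ f i) (hy : ∀ i < n, y ≠ f i)
    (hxt : HasType G f n a x) (hyt : HasType G f n b y) (hxy : G.Adj x y) :
    clash X a b = false := by
  by_contra hh
  simp only [clash, Bool.not_eq_false, Bool.or_eq_true, List.any_eq_true, bne_iff_ne,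
    Bool.and_eq_true, beq_iff_eq] at hh
  rcases hh with hab | ⟨e, he, h⟩
  · obtain ⟨i, hi⟩ := Nat.exists_testBit_of_ne_zero hab
    rw [Nat.testBit_land, Bool.and_eq_true] at hi
    have hin : i < n := by
      by_contra hin
      rw [Nat.testBit_lt_two_pow (ha.trans_le (Nat.pow_le_pow_right two_pos (not_lt.1 hin)))] at hi
      simp at hi
    exact hG.triangle_free _ _ _ hxy ((hxt i hin).1 hi.1) ((hyt i hin).1 hi.2)
  · obtain ⟨hen, hE⟩ := hX e he
    rcases h with ⟨h1, h2⟩ | ⟨h1, h2⟩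
    · exact hE x y (fun i hi => hx i (hi.trans_le hen)) (fun i hi => hy i (hi.trans_le hen))
        (h1 ▸ hxt.mod hen) (h2 ▸ hyt.mod hen) hxy
    · exact hE y x (fun i hi => hy i (hi.trans_le hen)) (fun i hi => hx i (hi.trans_le hen))
        (h2 ▸ hyt.mod hen) (h1 ▸ hxt.mod hen) hxy.symm

open Function in
lemma Compat.child (hG : Admissible G) {S : State} {f : ℕ → V} (h : Compat G S f) {t : ℕ}
    {W : List (ℕ × ℕ × ℕ)} {x : V} (ht : t < 2 ^ S.rows.length)
    (hx : ∀ i < S.rows.length, x ≠ f i) (hxt : HasType G f S.rows.length t x)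
    (hW : W.all (validWitness (S.rows ++ [t])) = true) :
    Compat G (S.child t W) (update f S.rows.length x) := by
  have hcore := h.core.append hx hxt
  refine ⟨hcore, fun y hy => ?_, fun e he => ?_⟩
  · have hlen : (S.child t W).rows.length = S.rows.length + 1 := by simp [State.child]
    have hy' : ∀ i < S.rows.length, y ≠ f i := fun i hi => by
      have := hy i (by omega)
      rwa [update_of_ne hi.ne] at this
    obtain ⟨m, hmS, hm, hmt⟩ := h.types y hy'
    have key : ∀ m' ∈ m :: (if clash S.excl t m then [] else [m + 2 ^ S.rows.length]),
        m' < 2 ^ (S.child t W).rows.length →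
        HasType G (update f S.rows.length x) (S.rows.length + 1) m' y →
        ∃ m ∈ (S.child t W).types, m < 2 ^ (S.child t W).rows.length ∧
          HasType G (update f S.rows.length x) (S.child t W).rows.length m y := by
      intro m' hm' hlt hty
      refine ⟨m', ?_, hlt, hlen ▸ hty⟩
      simp only [State.child, List.mem_filter, List.mem_flatMap]
      refine ⟨⟨m, hmS, hm'⟩, ?_⟩
      rw [hG.not_hits hcore hy (by simpa using hty) hW, Bool.not_false]
    by_cases hyx : G.Adj y x
    · refine key (m + 2 ^ S.rows.length) ?_ ?_ (hmt.add_two_pow hm hyx)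
      · rw [hG.not_clash h.excl ht hx hy' hxt hmt hyx.symm]
        simp
      · rw [hlen, pow_succ]
        omega
    · refine key m (by simp) ?_ (hmt.succ hm hyx)
      rw [hlen, pow_succ]
      omega
  · obtain ⟨hle, hE⟩ := h.excl e he
    refine ⟨by simp [State.child]; omega, hE.congr fun i hi => ?_⟩
    rw [update_of_ne (by omega)]

lemma Admissible.compat_root (hG : Admissible G) {A : List ℕ} {f : ℕ → V} (h : IsCore G A f)
    {W : List (ℕ × ℕ × ℕ)} (hW : W.all (validWitness A) = true) :
    Compat G (State.root A W) f := by
  classical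
  refine ⟨h, fun x hx => ?_, fun e he => by simp [State.root] at he⟩
  have hty : HasType G f A.length (Nat.ofBits fun i : Fin A.length => decide (G.Adj x (f i))) x :=
    fun i hi => by rw [Nat.testBit_ofBits_lt _ _ hi]; simp
  refine ⟨_, ?_, Nat.ofBits_lt_two_pow _, hty⟩
  have hlt := Nat.ofBits_lt_two_pow fun i : Fin A.length => decide (G.Adj x (f i))
  simp only [State.root, List.mem_filter, List.mem_range, Bool.and_eq_true, List.all_eq_true,
    hG.not_hits h hx hty hW, hlt, Bool.not_false, true_and]
  intro i hi
  by_contra hh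
  simp only [Bool.or_eq_true, Bool.not_eq_true', beq_iff_eq, not_or, Bool.not_eq_false] at hh
  obtain ⟨j, hj⟩ := Nat.exists_testBit_of_ne_zero hh.2
  rw [Nat.testBit_land, Nat.testBit_mod_two_pow, Bool.and_eq_true, Bool.and_eq_true,
    decide_eq_true_eq] at hj
  exact hG.triangle_free _ _ _ ((hty i hi).1 hh.1) ((hty j (hj.1.1.trans hi)).1 hj.1.2)
    ((h.adj_iff i hi j hj.1.1).1 hj.2)

lemma colorAt_lt (c i : ℕ) : colorAt c i < 3 := Nat.mod_lt _ (by norm_num)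

lemma Compat.not_comparableCheck (hG : Admissible G) {S : State} {f : ℕ → V} (h : Compat G S f)
    (p q : ℕ) : comparableCheck S p q = false := by
  by_contra hh
  simp only [comparableCheck, Bool.not_eq_false, Bool.and_eq_true, decide_eq_true_eq, bne_iff_ne,
    Bool.not_eq_true', List.all_eq_true, List.mem_range, Bool.or_eq_true] at hh
  obtain ⟨⟨⟨⟨⟨hp, hq⟩, hpq⟩, hadj⟩, hcore⟩, htypes⟩ := hh
  have hnadj : ¬ G.Adj (f p) (f q) := by
    rw [← h.core.adj_eq hp hq hpq, hadj]
    simp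
  obtain ⟨z, hpz, hqz⟩ := hG.not_comparable _ _ (h.core.injective hp hq hpq) hnadj
  by_cases hz : ∀ i < S.rows.length, z ≠ f i
  · obtain ⟨m, hm, -, hmt⟩ := h.types z hz
    rcases htypes m hm with h' | h'
    · exact absurd ((hmt p hp).2 hpz.symm) (by simp [h'])
    · exact hqz ((hmt q hq).1 h').symm
  · push Not at hz
    obtain ⟨i, hi, rfl⟩ := hz
    have hpi : p ≠ i := fun h' => G.loopless.irrefl _ (h' ▸ hpz)
    have hqi : q ≠ i := fun h' => hnadj (h' ▸ hpz)
    rcases hcore i hi with h' | h'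
    · exact absurd ((h.core.adj_eq hp hi hpi).2 hpz) (by simp [h'])
    · exact hqz ((h.core.adj_eq hq hi hqi).1 h')

open Function in
lemma Compat.not_colorCheck (hG : Admissible G) {S : State} {f : ℕ → V} (h : Compat G S f)
    (cK cT : ℕ) (W : List ℕ) : colorCheck S cK cT W = false := by
  classical
  by_contra hh
  simp only [colorCheck, Bool.not_eq_false, Bool.and_eq_true, List.all_eq_true, List.mem_range,
    Bool.or_eq_true, Bool.not_eq_true', bne_iff_ne, List.any_eq_true] at hh
  obtain ⟨hK, hT⟩ := hh
  have htype : ∀ x, (∀ i < S.rows.length, x ≠ f i) → ∃ k < S.types.length,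
      S.types.getD k 0 < 2 ^ S.rows.length ∧
        HasType G f S.rows.length (S.types.getD k 0) x := fun x hx => by
    obtain ⟨m, hm, hlt, hmt⟩ := h.types x hx
    obtain ⟨k, hk, rfl⟩ := List.getElem_of_mem hm
    exact ⟨k, hk, by rw [List.getD_eq_getElem _ _ hk]; exact ⟨hlt, hmt⟩⟩
  have hcol : ∀ x, ∃ c : Fin 3, (∃ i < S.rows.length, x = f i ∧ c = colorAt cK i) ∨
      (∀ i < S.rows.length, x ≠ f i) ∧ ∃ k < S.types.length, c = colorAt cT k ∧
        S.types.getD k 0 < 2 ^ S.rows.length ∧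
          HasType G f S.rows.length (S.types.getD k 0) x := fun x => by
    by_cases hx : ∀ i < S.rows.length, x ≠ f i
    · obtain ⟨k, hk, hlt, hkt⟩ := htype x hx
      exact ⟨⟨colorAt cT k, colorAt_lt _ _⟩, .inr ⟨hx, k, hk, rfl, hlt, hkt⟩⟩
    · push Not at hx
      obtain ⟨i, hi, rfl⟩ := hx
      exact ⟨⟨colorAt cK i, colorAt_lt _ _⟩, .inl ⟨i, hi, rfl, rfl⟩⟩
  choose c hc using hcol
  have hTT : ∀ k < S.types.length, ∀ l ≤ k, ∀ x y, G.Adj x y →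
      (∀ i < S.rows.length, x ≠ f i) → (∀ i < S.rows.length, y ≠ f i) →
      S.types.getD l 0 < 2 ^ S.rows.length → S.types.getD k 0 < 2 ^ S.rows.length →
      HasType G f S.rows.length (S.types.getD l 0) x →
      HasType G f S.rows.length (S.types.getD k 0) y → colorAt cT k ≠ colorAt cT l := by
    intro k hk l hl x y hxy hx hy hlt hkt hxt hyt
    rcases (hT k hk).2 l (by omega) with (h' | h') | ⟨w, -, h'⟩
    · exact h'
    · rw [hG.not_clash h.excl hlt hx hy hxt hyt hxy] at h'
      cases h'
    · have hcore := h.core.append hx hxt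
      have hyt' := hyt.add_two_pow hkt hxy.symm
      have hy' : ∀ i < S.rows.length + 1, y ≠ update f S.rows.length x i := fun i hi => by
        rcases (Nat.lt_succ_iff.1 hi).eq_or_lt with rfl | hi'
        · simpa using hxy.ne'
        · rw [update_of_ne hi'.ne]
          exact hy i hi'
      have hlen : (S.rows ++ [S.types.getD l 0]).length = S.rows.length + 1 := by simp
      exact absurd ((hcore.append (hlen ▸ hy') (hlen ▸ hyt')).of_embeds h') (hG.p2p4_free _)
  have hKT : ∀ k < S.types.length, ∀ i < S.rows.length, ∀ x, G.Adj x (f i) →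
      HasType G f S.rows.length (S.types.getD k 0) x → colorAt cT k ≠ colorAt cK i := by
    intro k hk i hi x hxi hxt
    rcases (hT k hk).1 i hi with h' | h'
    · have := (hxt i hi).2 hxi
      rw [h'] at this
      cases this
    · exact h'
  have hKK : ∀ i < S.rows.length, ∀ j < i, G.Adj (f i) (f j) → colorAt cK i ≠ colorAt cK j := by
    intro i hi j hj hij
    rcases hK i hi j hj with h' | h'
    · exact absurd ((h.core.adj_iff i hi j hj).2 hij) (by simp [h'])
    · exact h'
  refine hG.not_colorable ⟨SimpleGraph.Coloring.mk c fun {x y} hxy heq => ?_⟩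
  have hv := congrArg Fin.val heq
  rcases hc x with ⟨i, hi, rfl, hci⟩ | ⟨hx, k, hk, hck, hklt, hkt⟩ <;>
  rcases hc y with ⟨j, hj, rfl, hcj⟩ | ⟨hy, l, hl, hcl, hllt, hlt⟩
  · rcases lt_trichotomy i j with hij | rfl | hij
    · exact hKK j hj i hij hxy.symm (by omega)
    · exact G.loopless.irrefl _ hxy
    · exact hKK i hi j hij hxy (by omega)
  · exact hKT l hl i hi y hxy.symm hlt (by omega)
  · exact hKT k hk j hj x hxy hkt (by omega)
  · rcases le_total k l with hkl | hkl
    · exact hTT l hl k hkl x y hxy hx hy hklt hllt hkt hlt (by omega)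
    · exact hTT k hk l hkl y x hxy.symm hy hx hllt hklt hlt hkt (by omega)

open Function in
lemma Admissible.not_refutes (hG : Admissible G) {Γ : List (List ℕ)}
    (hΓ : ∀ B ∈ Γ, ∀ f, ¬ IsCore G B f) (c : Cert) (S : State) (f : ℕ → V) (h : Compat G S f) :
    refutes Γ S c = false := by
  induction c generalizing S f with
  | type t W c c' ihc ihc' =>
    by_contra hh
    simp only [refutes, Bool.not_eq_false, Bool.and_eq_true] at hh
    obtain ⟨⟨hW, hc⟩, hc'⟩ := hh
    have hno : ∀ x, (∀ i < S.rows.length, x ≠ f i) → t < 2 ^ S.rows.length →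
        ¬ HasType G f S.rows.length t x := fun x hx ht hxt => by
      have := ihc _ _ (h.child hG ht hx hxt hW)
      simp_all
    refine absurd (ihc' ⟨S.rows, S.types.filter (· != t), S.excl⟩ f
      ⟨h.core, fun x hx => ?_, h.excl⟩) (by simp [hc'])
    obtain ⟨m, hm, hlt, hmt⟩ := h.types x hx
    refine ⟨m, ?_, hlt, hmt⟩
    simp only [List.mem_filter, bne_iff_ne]
    exact ⟨hm, fun h' => hno x hx (h' ▸ hlt) (h' ▸ hmt)⟩
  | edge a b W c c' ihc ihc' =>
    by_contra hh
    simp only [refutes, Bool.not_eq_false, Bool.and_eq_true] at hh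
    obtain ⟨⟨⟨⟨ha, hb⟩, hW⟩, hc⟩, hc'⟩ := hh
    rw [decide_eq_true_eq] at ha hb
    have hno : IsExcluded G f (S.rows.length, a, b) := fun x y hx hy hxt hyt hxy => by
      have h1 := h.child hG ha hx hxt (W := []) (by simp)
      have hlen : (S.child a []).rows.length = S.rows.length + 1 := by simp [State.child]
      have h2 := h1.child hG (t := b + 2 ^ S.rows.length) (x := y) (W := W)
        (by rw [hlen, pow_succ]; omega) (fun i hi => ?_)
        (by rw [hlen]; exact hyt.add_two_pow hb hxy.symm) hW
      · have := ihc _ _ h2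
        simp_all
      · rcases (show i ≤ S.rows.length by omega).eq_or_lt with rfl | hi'
        · simpa using hxy.ne'
        · rw [update_of_ne hi'.ne]
          exact hy i hi'
    refine absurd (ihc' ⟨S.rows, S.types, (S.rows.length, a, b) :: S.excl⟩ f
      ⟨h.core, h.types, fun e he => ?_⟩) (by simp [hc'])
    rcases List.mem_cons.1 he with rfl | he
    · exact ⟨le_rfl, hno⟩
    · exact h.excl e he
  | known i w =>
    by_contra hh
    simp only [refutes, Bool.not_eq_false, Bool.and_eq_true, decide_eq_true_eq] at hh
    refine hΓ (Γ.getD i []) ?_ _ (h.core.of_embeds hh.2)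
    rw [List.getD_eq_getElem _ _ hh.1]
    exact List.getElem_mem _
  | comparable p q => exact h.not_comparableCheck hG p q
  | color cK cT W => exact h.not_colorCheck hG cK cT W

lemma Admissible.not_isCore (hG : Admissible G) {Γ : List (List ℕ)}
    (hΓ : ∀ B ∈ Γ, ∀ f, ¬ IsCore G B f) {A : List ℕ} {W : List (ℕ × ℕ × ℕ)} {c : Cert}
    (hc : refutesCore Γ A W c = true) (f : ℕ → V) : ¬ IsCore G A f := fun h => by
  rw [refutesCore, Bool.and_eq_true] at hc
  exact absurd hc.2 (by simp [hG.not_refutes hΓ c _ f (hG.compat_root h hc.1)])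

/-- Adjacency in the Clebsch graph, its vertices being coded by the numbers below `16`. -/
def clebschAdj (p q : ℕ) : Bool := [1, 2, 4, 8, 15].contains (p ^^^ q)

/-- The Clebsch vertices corresponding to the vertices of the Grötzsch graph. -/
def corePoint (i : ℕ) : ℕ := [0, 1, 2, 4, 8, 15, 9, 13, 5, 10, 11].getD i 0

/-- The types that a vertex outside a Grötzsch graph may have, and the corresponding Clebsch
vertices. -/
def typePoints : List (ℕ × ℕ) := [(76, 6), (152, 12), (304, 7), (546, 14), (1030, 3)]

/-- The Clebsch vertex corresponding to the type `t`. -/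
def typePoint (t : ℕ) : ℕ := (typePoints.lookup t).getD 0

/-- The state with a Grötzsch graph as core and all types that can occur. -/
def grotzschState : State := ⟨rowsGrotzsch, typePoints.map Prod.fst, []⟩

/-- All types over the Grötzsch graph except those in `typePoints` create comparable pairs. -/
def rareTypesCheck : Bool :=
  witGrotzsch.all (validWitness rowsGrotzsch) &&
  (State.root rowsGrotzsch witGrotzsch).types.all fun m =>
    grotzschState.types.contains m || rareTypes.any fun e => e.1 == m &&
      e.2.2.2.all (validWitness (rowsGrotzsch ++ [m])) &&
      comparableCheck ((State.root rowsGrotzsch witGrotzsch).child m e.2.2.2) e.2.1 e.2.2.1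

/-- Distinct vertices outside the Grötzsch graph have distinct types and are joined as in the
Clebsch graph. -/
def twinCheck : Bool :=
  grotzschState.types.all fun t => decide (t < 2 ^ 11) && twinWitnesses.any fun e => e.1 == t &&
    e.2.1.all (validWitness (rowsGrotzsch ++ [t])) &&
    e.2.2.all (validWitness (rowsGrotzsch ++ [t] ++ [t])) &&
    comparableCheck ((grotzschState.child t e.2.1).child t e.2.2) 11 12 &&
    (grotzschState.child t e.2.1).types.all fun m => m == t ||
      ((m.testBit 11 == clebschAdj (typePoint t) (typePoint (m % 2 ^ 11))) &&
        typePoint t != typePoint (m % 2 ^ 11))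

/-- The table of Clebsch vertices is correct on the core. -/
def pointCheck : Bool :=
  ((List.range 11).all fun i => decide (corePoint i < 16) && (List.range i).all fun j =>
    ((row rowsGrotzsch i).testBit j == clebschAdj (corePoint i) (corePoint j)) &&
      corePoint i != corePoint j) &&
  grotzschState.types.all fun t => decide (typePoint t < 16) && (List.range 11).all fun i =>
    (t.testBit i == clebschAdj (typePoint t) (corePoint i)) && typePoint t != corePoint i

set_option maxRecDepth 100000 in
lemma rareTypesCheck_eq : rareTypesCheck = true := by decide +kernel

set_option maxRecDepth 100000 in
lemma twinCheck_eq : twinCheck = true := by decide +kernel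

lemma pointCheck_eq : pointCheck = true := by decide +kernel

lemma clebschAdj_comm (p q : ℕ) : clebschAdj p q = clebschAdj q p := by
  rw [clebschAdj, Nat.xor_comm, ← clebschAdj]

lemma Admissible.compat_grotzschState (hG : Admissible G) {f : ℕ → V}
    (h : IsCore G rowsGrotzsch f) : Compat G grotzschState f := by
  have hcheck := rareTypesCheck_eq
  simp only [rareTypesCheck, Bool.and_eq_true, List.all_eq_true (p := fun m => _ || _),
    Bool.or_eq_true, List.contains_iff_mem, List.any_eq_true, beq_iff_eq] at hcheck
  obtain ⟨hW, hT⟩ := hcheck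
  have hroot := hG.compat_root h hW
  refine ⟨h, fun x hx => ?_, by simp [grotzschState]⟩
  obtain ⟨m, hm, hlt, hmt⟩ := hroot.types x hx
  refine ⟨m, ?_, hlt, hmt⟩
  rcases hT m hm with h' | ⟨e, -, ⟨rfl, hW'⟩, hcomp⟩
  · exact h'
  · rw [(hroot.child hG hlt hx hmt hW').not_comparableCheck hG] at hcomp
    cases hcomp

lemma HasType.eq {f : ℕ → V} {n a b : ℕ} {x : V} (ha : HasType G f n a x) (hb : HasType G f n b x)
    (ha' : a < 2 ^ n) (hb' : b < 2 ^ n) : a = b := by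
  refine Nat.eq_of_testBit_eq fun i => ?_
  rcases lt_or_ge i n with hi | hi
  · exact Bool.eq_iff_iff.2 ((ha i hi).trans (hb i hi).symm)
  · have hp := Nat.pow_le_pow_right two_pos hi
    rw [Nat.testBit_lt_two_pow (ha'.trans_le hp), Nat.testBit_lt_two_pow (hb'.trans_le hp)]

open Function in
lemma Compat.adj_iff_clebschAdj (hG : Admissible G) {f : ℕ → V} (h : Compat G grotzschState f)
    {x y : V} (hx : ∀ i < 11, x ≠ f i) (hy : ∀ i < 11, y ≠ f i) (hxy : x ≠ y) {t s : ℕ}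
    (ht : t ∈ grotzschState.types) (hs : s ∈ grotzschState.types)
    (hxt : HasType G f 11 t x) (hys : HasType G f 11 s y) :
    typePoint t ≠ typePoint s ∧ (G.Adj x y ↔ clebschAdj (typePoint t) (typePoint s) = true) := by
  have hcheck := twinCheck_eq
  rw [twinCheck, List.all_eq_true] at hcheck
  have hslt := hcheck s hs
  have htc := hcheck t ht
  simp only [Bool.and_eq_true, decide_eq_true_eq, List.any_eq_true, beq_iff_eq] at hslt htc
  obtain ⟨htlt, e, -, ⟨⟨⟨rfl, hW⟩, hW'⟩, hcomp⟩, htypes⟩ := htc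
  replace hslt := hslt.1
  have hc := h.child hG htlt hx hxt hW
  have hy' : ∀ i < 12, y ≠ update f 11 x i := fun i hi => by
    rcases (show i ≤ 11 by omega).eq_or_lt with rfl | hi'
    · simpa using hxy.symm
    · rw [update_of_ne hi'.ne]
      exact hy i hi'
  obtain ⟨m, hm, hmlt, hmt⟩ := hc.types y hy'
  change m < 2 ^ 12 at hmlt
  change HasType G (update f 11 x) 12 m y at hmt
  have hms : m % 2 ^ 11 = s :=
    ((hmt.mod (by norm_num)).congr fun i hi => update_of_ne hi.ne _ _).eq hys
      (Nat.mod_lt _ (by norm_num)) hslt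
  have hne : m ≠ e.1 := fun hme => by
    have hlt : e.1 < 2 ^ 12 := htlt.trans (by norm_num)
    have hcc := hc.child hG (t := e.1) (x := y) (W := e.2.2) hlt hy' (hme ▸ hmt) hW'
    rw [hcc.not_comparableCheck hG] at hcomp
    cases hcomp
  have hfin := List.all_eq_true.1 htypes m hm
  simp only [Bool.or_eq_true, beq_iff_eq, hne, false_or, Bool.and_eq_true, bne_iff_ne, hms] at hfin
  refine ⟨hfin.2, ?_⟩
  rw [← hfin.1, hmt 11 (by norm_num), update_self, G.adj_comm]

lemma Admissible.exists_clebsch_map (hG : Admissible G) {f : ℕ → V}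
    (h : IsCore G rowsGrotzsch f) : ∃ p : V → ℕ, (∀ x, p x < 16) ∧
      ∀ x y, x ≠ y → p x ≠ p y ∧ (G.Adj x y ↔ clebschAdj (p x) (p y) = true) := by
  have hS := hG.compat_grotzschState h
  have hcheck := pointCheck_eq
  simp only [pointCheck, Bool.and_eq_true, List.all_eq_true, decide_eq_true_eq, beq_iff_eq,
    bne_iff_ne, List.mem_range] at hcheck
  obtain ⟨hK, hT⟩ := hcheck
  have hp : ∀ x, ∃ p, (∃ i < 11, x = f i ∧ p = corePoint i) ∨ (∀ i < 11, x ≠ f i) ∧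
      ∃ t ∈ grotzschState.types, HasType G f 11 t x ∧ p = typePoint t := fun x => by
    by_cases hx : ∀ i < 11, x ≠ f i
    · obtain ⟨t, ht, -, hxt⟩ := hS.types x hx
      exact ⟨_, .inr ⟨hx, t, ht, hxt, rfl⟩⟩
    · push Not at hx
      obtain ⟨i, hi, rfl⟩ := hx
      exact ⟨_, .inl ⟨i, hi, rfl, rfl⟩⟩
  choose p hp using hp
  have hKK : ∀ i < 11, ∀ j < i, corePoint i ≠ corePoint j ∧
      (G.Adj (f i) (f j) ↔ clebschAdj (corePoint i) (corePoint j) = true) := fun i hi j hj => by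
    obtain ⟨h1, h2⟩ := (hK i hi).2 j hj
    rw [← h1, h.adj_iff i hi j hj]
    exact ⟨h2, Iff.rfl⟩
  have hTK : ∀ t ∈ grotzschState.types, ∀ x, HasType G f 11 t x → ∀ i < 11,
      typePoint t ≠ corePoint i ∧
        (G.Adj x (f i) ↔ clebschAdj (typePoint t) (corePoint i) = true) := fun t ht x hx i hi => by
    obtain ⟨h1, h2⟩ := (hT t ht).2 i hi
    rw [← h1, hx i hi]
    exact ⟨h2, Iff.rfl⟩
  refine ⟨p, fun x => ?_, fun x y hxy => ?_⟩
  · rcases hp x with ⟨i, hi, -, hpi⟩ | ⟨-, t, ht, -, hpt⟩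
    · exact hpi ▸ (hK i hi).1
    · exact hpt ▸ (hT t ht).1
  · rcases hp x with ⟨i, hi, rfl, hpi⟩ | ⟨hx, t, ht, hxt, hpt⟩ <;>
    rcases hp y with ⟨j, hj, rfl, hpj⟩ | ⟨hy, s, hs, hys, hps⟩
    · rw [hpi, hpj]
      rcases lt_trichotomy i j with hij | rfl | hij
      · rw [G.adj_comm, clebschAdj_comm, ne_comm]
        exact hKK j hj i hij
      · exact absurd rfl hxy
      · exact hKK i hi j hij
    · rw [hpi, hps, G.adj_comm, clebschAdj_comm, ne_comm]
      exact hTK s hs y hys i hi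
    · rw [hpt, hpj]
      exact hTK t ht x hxt j hj
    · rw [hpt, hps]
      exact hS.adj_iff_clebschAdj hG hx hy hxy ht hs hxt hys

end TypeRefutation

section

open TypeRefutation

variable {V : Type*} {G : SimpleGraph V}

lemma TypeRefutation.IsCore.containsInduced {A : List ℕ} {n : ℕ} {H : SimpleGraph (Fin n)}
    {f : ℕ → V} (h : IsCore G A f) (hn : A.length = n)
    (hH : ∀ i j : Fin n, j < i → ((row A i).testBit j = true ↔ H.Adj i j)) :
    ContainsInduced H G := by
  subst hn
  refine ⟨⟨fun i => f i, fun i j hij => ?_⟩, fun i j => ?_⟩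
  · by_contra hne
    exact h.injective i.2 j.2 (fun h' => hne (Fin.ext h')) hij
  · change G.Adj (f i) (f j) ↔ _
    rcases lt_trichotomy i j with hij | rfl | hij
    · rw [H.adj_comm, G.adj_comm, ← hH j i hij, h.adj_iff j j.2 i hij]
    · simp
    · rw [← hH i j hij, h.adj_iff i i.2 j hij]

lemma isCore_p2UnionP4 {f : ℕ → V} (h : IsCore G rowsP2P4 f) : ContainsInduced P2UnionP4 G :=
  h.containsInduced rfl (by simp only [P2UnionP4, fromEdgeSet_adj]; decide)

lemma isCore_grotzschGraph {f : ℕ → V} (h : IsCore G rowsGrotzsch f) :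
    ContainsInduced GrotzschGraph G :=
  h.containsInduced rfl (by simp only [GrotzschGraph, fromEdgeSet_adj]; decide)

/-- In a paw-free graph every neighbour of a vertex of a triangle lies in the triangle or is
adjacent to a second vertex of it. -/
lemma adj_or_adj_of_paw_free (hpaw : ¬ ContainsInduced PawGraph G) {a b c d : V}
    (hab : G.Adj a b) (hac : G.Adj a c) (hbc : G.Adj b c) (had : G.Adj a d) (hdb : d ≠ b)
    (hdc : d ≠ c) : G.Adj b d ∨ G.Adj c d := by
  by_contra! h
  refine hpaw (IsCore.containsInduced (A := [0, 1, 3, 1])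
    (f := fun i => [a, b, c, d].getD i a) ⟨fun i hi j hj => ?_, fun i hi j hj => ?_⟩ rfl
    (by simp only [PawGraph, fromEdgeSet_adj]; decide))
  · simp only [List.length_cons, List.length_nil] at hi
    interval_cases i <;> interval_cases j <;>
      simp [row, Nat.testBit, hab.symm, hac.symm, hbc.symm, had.symm, h.1, h.2, G.adj_comm d]
  · simp only [List.length_cons, List.length_nil] at hi
    interval_cases i <;> interval_cases j <;>
      simp [hab.ne', hac.ne', hbc.ne', had.ne', hdb, hdc]

/-- Every vertex of a connected paw-free graph is adjacent to two vertices of any given triangle. -/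
lemma adj_two_of_paw_free (hconn : G.Connected) (hpaw : ¬ ContainsInduced PawGraph G) {a b c : V}
    (hab : G.Adj a b) (hac : G.Adj a c) (hbc : G.Adj b c) (x : V) :
    G.Adj a x ∧ G.Adj b x ∨ G.Adj a x ∧ G.Adj c x ∨ G.Adj b x ∧ G.Adj c x := by
  have two : ∀ y, y = a ∨ y = b ∨ y = c ∨ G.Adj a y ∨ G.Adj b y ∨ G.Adj c y →
      G.Adj a y ∧ G.Adj b y ∨ G.Adj a y ∧ G.Adj c y ∨ G.Adj b y ∧ G.Adj c y := by
    intro y hy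
    by_cases hya : y = a
    · exact .inr (.inr (hya ▸ ⟨hab.symm, hac.symm⟩))
    by_cases hyb : y = b
    · exact .inr (.inl (hyb ▸ ⟨hab, hbc.symm⟩))
    by_cases hyc : y = c
    · exact .inl (hyc ▸ ⟨hac, hbc⟩)
    have h1 := fun h => adj_or_adj_of_paw_free hpaw hab hac hbc (d := y) h hyb hyc
    have h2 := fun h => adj_or_adj_of_paw_free hpaw hab.symm hbc hac (d := y) h hya hyc
    have h3 := fun h => adj_or_adj_of_paw_free hpaw hac.symm hbc.symm hab (d := y) h hya hyb
    tauto
  obtain ⟨p⟩ := hconn.preconnected x a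
  induction p with
  | nil => exact two _ (.inl rfl)
  | @cons x y a hxy p ih =>
    have key : ∀ {u v : V}, G.Adj u v → G.Adj u y ∧ G.Adj v y →
        x = u ∨ x = v ∨ G.Adj u x ∨ G.Adj v x := fun {u v} huv ⟨hu, hv⟩ => by
      by_cases hxu : x = u
      · exact .inl hxu
      by_cases hxv : x = v
      · exact .inr (.inl hxv)
      exact .inr (.inr (adj_or_adj_of_paw_free hpaw hu.symm hv.symm huv hxy.symm hxu hxv))
    apply two
    rcases ih hab hac two with h | h | h
    · have := key hab h
      tauto
    · have := key hac h
      tauto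
    · have := key hbc h
      tauto

/-- A connected paw-free graph with a triangle is complete multipartite. -/
lemma comparable_or_complete_of_triangle (hconn : G.Connected)
    (hpaw : ¬ ContainsInduced PawGraph G) {a b c : V}
    (hab : G.Adj a b) (hac : G.Adj a c) (hbc : G.Adj b c) :
    (∃ u v : V, u ≠ v ∧ ¬ G.Adj u v ∧ G.neighborSet u ⊆ G.neighborSet v) ∨
    ∀ u v : V, u ≠ v → G.Adj u v := by
  by_contra! h
  obtain ⟨hcomp, u, v, huv, hnadj⟩ := h
  obtain ⟨w, huw, hvw⟩ := Set.not_subset.1 (hcomp u v huv hnadj)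
  rw [mem_neighborSet] at huw hvw
  obtain ⟨z, huz, hwz⟩ : ∃ z, G.Adj u z ∧ G.Adj w z := by
    have hu := adj_two_of_paw_free hconn hpaw hab hac hbc u
    have hw := adj_two_of_paw_free hconn hpaw hab hac hbc w
    have : (G.Adj a u ∧ G.Adj a w) ∨ (G.Adj b u ∧ G.Adj b w) ∨ (G.Adj c u ∧ G.Adj c w) := by tauto
    rcases this with h | h | h <;> exact ⟨_, h.1.symm, h.2.symm⟩
  have := adj_two_of_paw_free hconn hpaw huw huz hwz v
  rw [G.adj_comm w v] at this
  tauto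

/-- The edges of `G` that are not incident with a neighbour of `d`. -/
def SimpleGraph.awayFrom (G : SimpleGraph V) (d : V) : SimpleGraph V where
  Adj x y := G.Adj x y ∧ ¬ G.Adj d x ∧ ¬ G.Adj d y
  symm := ⟨fun _ _ h => ⟨h.1.symm, h.2.2, h.2.1⟩⟩
  loopless := ⟨fun _ h => G.loopless.irrefl _ h.1⟩

lemma not_colorable_two_awayFrom (hG : Admissible G) (d : V) : ¬ (G.awayFrom d).Colorable 2 := by
  classical
  rintro ⟨C⟩
  refine hG.not_colorable ⟨Coloring.mk
    (fun x => if G.Adj d x then Fin.last 2 else (C x).castSucc) fun {x y} hxy => ?_⟩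
  by_cases hx : G.Adj d x <;> by_cases hy : G.Adj d y
  · exact absurd hxy (hG.triangle_free _ _ _ hx hy)
  · simpa [hx, hy] using (Fin.castSucc_lt_last (C y)).ne'
  · simpa [hx, hy] using (Fin.castSucc_lt_last (C x)).ne
  · have : (G.awayFrom d).Adj x y := ⟨hxy, hx, hy⟩
    simpa [hx, hy] using C.valid this

lemma SimpleGraph.Walk.exists_subwalk {u v : V} (w : G.Walk u v) {i j : ℕ} (hij : i ≤ j)
    (hj : j ≤ w.length) : ∃ p : G.Walk (w.getVert i) (w.getVert j), p.length = j - i := by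
  induction j, hij using Nat.le_induction with
  | base => exact ⟨.nil, by simp⟩
  | succ j hij ih =>
    obtain ⟨p, hp⟩ := ih (by omega)
    exact ⟨p.concat (w.adj_getVert_succ (by omega)), by simp [hp]; omega⟩

/-- A shortest odd closed walk is an induced cycle. -/
lemma exists_induced_odd_cycle (h : ¬ G.Colorable 2) : ∃ n, Odd n ∧ ∃ c : ℕ → V,
    G.Adj (c (n - 1)) (c 0) ∧ (∀ i < n - 1, G.Adj (c i) (c (i + 1))) ∧
    ∀ i < n, ∀ j < i, c i ≠ c j ∧ (G.Adj (c i) (c j) ↔ i = j + 1 ∨ j = 0 ∧ i = n - 1) := by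
  classical
  rw [two_colorable_iff_forall_loop_even] at h
  push Not at h
  have hex : ∃ n, Odd n ∧ ∃ u, ∃ w : G.Walk u u, w.length = n := by
    obtain ⟨u, w, hw⟩ := h
    exact ⟨_, Nat.not_even_iff_odd.1 hw, u, w, rfl⟩
  obtain ⟨hodd, u, w, hw⟩ := Nat.find_spec hex
  have hmin : ∀ v, ∀ p : G.Walk v v, Odd p.length → Nat.find hex ≤ p.length :=
    fun v p hp => Nat.find_min' hex ⟨hp, v, p, rfl⟩
  generalize Nat.find hex = n at hodd hw hmin
  have hlast : w.getVert n = w.getVert 0 := by rw [← hw]; simp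
  have hsucc : ∀ i < n, G.Adj (w.getVert i) (w.getVert (i + 1)) :=
    fun i hi => w.adj_getVert_succ (hw ▸ hi)
  have hpos := hodd.pos
  have hback : G.Adj (w.getVert (n - 1)) (w.getVert 0) := by
    have := hsucc (n - 1) (by omega)
    rwa [Nat.sub_add_cancel hpos, hlast] at this
  refine ⟨n, hodd, w.getVert, hback, fun i hi => hsucc i (by omega), fun i hi j hj => ?_⟩
  obtain ⟨p, hp⟩ := w.exists_subwalk hj.le (hw ▸ hi.le)
  obtain ⟨q, hq⟩ : ∃ q : G.Walk (w.getVert i) (w.getVert 0), q.length = n - i :=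
    hlast ▸ w.exists_subwalk hi.le hw.ge
  obtain ⟨r, hr⟩ := w.exists_subwalk (Nat.zero_le j) (by omega)
  have hqr : (q.append r).length = n - i + j := by simp [hq, hr]
  refine ⟨fun heq => ?_, fun hadj => ?_, ?_⟩
  · rcases Nat.even_or_odd (i - j) with hev | hod
    · have := hmin _ ((q.append r).copy heq rfl) (by
        rw [Walk.length_copy, hqr]
        rw [Nat.odd_iff] at hodd ⊢
        rw [Nat.even_iff] at hev
        omega)
      rw [Walk.length_copy, hqr] at this
      omega
    · have := hmin _ (p.copy rfl heq) (by rwa [Walk.length_copy, hp])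
      rw [Walk.length_copy, hp] at this
      omega
  · rcases Nat.even_or_odd (i - j) with hev | hod
    · have := hmin _ (p.cons hadj) (by rw [Walk.length_cons, hp]; exact hev.add_one)
      rw [Walk.length_cons, hp] at this
      omega
    · have := hmin _ ((q.append r).cons hadj.symm) (by
        rw [Walk.length_cons, hqr]
        rw [Nat.odd_iff] at hodd hod ⊢
        omega)
      rw [Walk.length_cons, hqr] at this
      omega
  · rintro (rfl | ⟨rfl, rfl⟩)
    · exact (hsucc j (by omega)).symm
    · exact hback

/-- An admissible graph contains an induced 5-cycle or 7-cycle without edges to a given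
vertex `d`. -/
lemma exists_isCore_cycle (hG : Admissible G) (d : V) :
    ∃ f, IsCore G rowsCycleFive f ∨ IsCore G rowsCycleSeven f := by
  obtain ⟨n, hodd, c, hback, hsucc, hc⟩ :=
    exists_induced_odd_cycle (not_colorable_two_awayFrom hG d)
  have hd : ∀ i < n, ¬ G.Adj d (c i) := fun i hi => by
    rcases (show i ≤ n - 1 by omega).eq_or_lt with rfl | hi'
    · exact hback.2.1
    · exact (hsucc i hi').2.1
  have hne : ∀ i < n, d ≠ c i := fun i hi h => by
    rcases (show i ≤ n - 1 by omega).eq_or_lt with rfl | hi'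
    · exact hd 0 hodd.pos (h ▸ hback.1)
    · exact hd (i + 1) (by omega) (h ▸ (hsucc i hi').1)
  have hadj : ∀ i < n, ∀ j < i, G.Adj (c i) (c j) ↔ i = j + 1 ∨ j = 0 ∧ i = n - 1 :=
    fun i hi j hj => by
    rw [← ((hc i hi j hj).2)]
    exact ⟨fun h => ⟨h, hd i hi, hd j (hj.trans hi)⟩, fun h => h.1⟩
  have hcore : ∀ A : List ℕ, A.length = n →
      (∀ i < n, ∀ j < i, (row A i).testBit j = true ↔ i = j + 1 ∨ j = 0 ∧ i = n - 1) →
      IsCore G (A ++ [0]) (Function.update c A.length d) := fun A hA hrow => by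
    refine IsCore.append ⟨fun i hi j hj => ?_, fun i hi j hj => ?_⟩ (hA ▸ hne)
      fun i hi => by simpa using hd i (hA ▸ hi)
    · rw [hrow i (hA ▸ hi) j hj, hadj i (hA ▸ hi) j hj]
    · exact (hc i (hA ▸ hi) j hj).1
  have h5 : n ≠ 1 ∧ n ≠ 3 := by
    constructor
    · rintro rfl
      exact G.loopless.irrefl _ hback.1
    · rintro rfl
      exact hG.triangle_free _ _ _ (hsucc 0 (by omega)).1 hback.1.symm (hsucc 1 (by omega)).1
  rcases lt_trichotomy n 7 with h | rfl | h
  · obtain rfl : n = 5 := by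
      obtain ⟨k, rfl⟩ := hodd
      omega
    exact ⟨_, .inl (hcore [0, 1, 2, 4, 9] rfl (by decide))⟩
  · exact ⟨_, .inr (hcore [0, 1, 2, 4, 8, 16, 33] rfl (by decide))⟩
  · have h8 : 7 < n - 1 := by
      obtain ⟨k, rfl⟩ := hodd
      omega
    have hlt : ∀ i < 6, ∀ j < i, [0, 1, 3, 4, 5, 6].getD j 0 < [0, 1, 3, 4, 5, 6].getD i 0 ∧
        [0, 1, 3, 4, 5, 6].getD i 0 < 7 := by decide
    have hrow : ∀ i < 6, ∀ j < i, (row rowsP2P4 i).testBit j = true ↔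
        [0, 1, 3, 4, 5, 6].getD i 0 = [0, 1, 3, 4, 5, 6].getD j 0 + 1 := by decide
    refine absurd ⟨fun i hi j hj => ?_, fun i hi j hj => ?_⟩
      (hG.p2p4_free fun i => c ([0, 1, 3, 4, 5, 6].getD i 0))
    · have hl := hlt i hi j hj
      rw [hrow i hi j hj, hadj _ (by omega) _ hl.1]
      omega
    · have hl := hlt i hi j hj
      exact (hc _ (by omega) _ hl.1).1

lemma exists_isCore_grotzsch (hG : Admissible G) (d : V) : ∃ f, IsCore G rowsGrotzsch f := by
  by_contra! h
  have h1 : ∀ B ∈ [rowsGrotzsch], ∀ f, ¬ IsCore G B f := by simpa using h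
  have hs9 := hG.not_isCore h1 refutesCore_CapExt
  have h2 : ∀ B ∈ [rowsGrotzsch, rowsCapExt], ∀ f, ¬ IsCore G B f := by simpa using ⟨h, hs9⟩
  have hs8 := hG.not_isCore h2 refutesCore_Cap
  have h3 : ∀ B ∈ [rowsGrotzsch, rowsCapExt, rowsCap], ∀ f, ¬ IsCore G B f := by
    simpa using ⟨h, hs9, hs8⟩
  have hs5 := hG.not_isCore h3 refutesCore_CycleFive
  have h4 : ∀ B ∈ [rowsGrotzsch, rowsCapExt, rowsCap, rowsCycleFive], ∀ f, ¬ IsCore G B f := by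
    simpa using ⟨h, hs9, hs8, hs5⟩
  obtain ⟨f, hf | hf⟩ := exists_isCore_cycle hG d
  · exact hs5 f hf
  · exact hG.not_isCore h4 refutesCore_CycleSeven f hf

/-- The vertex of the Clebsch graph coded by `p`. -/
def clebschVertex (p : ℕ) (i : Fin 4) : ZMod 2 := if p.testBit i then 1 else 0

lemma clebschVertex_injOn : ∀ p < 16, ∀ q < 16, clebschVertex p = clebschVertex q → p = q := by
  decide +kernel

set_option synthInstance.maxHeartbeats 400000 in
set_option synthInstance.maxSize 1000 in
lemma adj_clebschVertex : ∀ p < 16, ∀ q < 16,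
    ClebschGraph.Adj (clebschVertex p) (clebschVertex q) ↔ clebschAdj p q = true := by
  simp only [ClebschGraph, fromRel_adj, Set.mem_insert_iff, Set.mem_singleton_iff]
  decide +kernel

/-- A 4-coloring of the Clebsch graph. -/
def clebschColor (p : ℕ) : ℕ := 3955114260 / 4 ^ p % 4

lemma clebschAdj_color : ∀ p < 16, ∀ q < 16, clebschAdj p q = true →
    clebschColor p ≠ clebschColor q := by
  decide +kernel

lemma chromaticNumber_eq_four (hG : Admissible G) {p : V → ℕ} (hp : ∀ x, p x < 16)
    (hadj : ∀ x y, x ≠ y → (G.Adj x y ↔ clebschAdj (p x) (p y) = true)) :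
    G.chromaticNumber = 4 := by
  refine le_antisymm (Colorable.chromaticNumber_le (n := 4) ⟨Coloring.mk
    (fun x => ⟨clebschColor (p x), Nat.mod_lt _ (by norm_num)⟩) fun {x y} hxy h => ?_⟩) ?_
  · exact clebschAdj_color _ (hp x) _ (hp y) ((hadj x y hxy.ne).1 hxy) (congrArg Fin.val h)
  · by_contra! h
    exact hG.not_colorable
      (chromaticNumber_le_iff_colorable.1 ((ENat.lt_add_one_iff (by simp)).1 h))

end

theorem statement_8 {V : Type*} [Fintype V] (G : SimpleGraph V)
    (hconn : G.Connected)
    (hP : ¬ ContainsInduced P2UnionP4 G)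
    (hpaw : ¬ ContainsInduced PawGraph G) :
    (∃ u v : V, u ≠ v ∧ ¬ G.Adj u v ∧ G.neighborSet u ⊆ G.neighborSet v) ∨
    (∀ u v : V, u ≠ v → G.Adj u v) ∨
    (ContainsInduced GrotzschGraph G ∧ ContainsInduced G ClebschGraph ∧
      G.chromaticNumber = 4) ∨
    G.chromaticNumber ≤ 3 := by
  by_cases htri : ∃ a b c, G.Adj a b ∧ G.Adj a c ∧ G.Adj b c
  · obtain ⟨a, b, c, hab, hac, hbc⟩ := htri
    rcases comparable_or_complete_of_triangle hconn hpaw hab hac hbc with h | h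
    · exact .inl h
    · exact .inr (.inl h)
  by_cases hcomp : ∃ u v : V, u ≠ v ∧ ¬ G.Adj u v ∧ G.neighborSet u ⊆ G.neighborSet v
  · exact .inl hcomp
  by_cases hcol : G.Colorable 3
  · exact .inr (.inr (.inr hcol.chromaticNumber_le))
  have hG : TypeRefutation.Admissible G := by
    refine ⟨fun x y z hxy hxz hyz => htri ⟨x, y, z, hxy, hxz, hyz⟩,
      fun f hf => hP (isCore_p2UnionP4 hf), fun x y hxy hnadj => ?_, hcol⟩
    by_contra! h
    exact hcomp ⟨x, y, hxy, hnadj, fun z hz => h z hz⟩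
  obtain ⟨d⟩ := hconn.nonempty
  obtain ⟨f, hf⟩ := exists_isCore_grotzsch hG d
  obtain ⟨p, hp, hadj⟩ := hG.exists_clebsch_map hf
  refine .inr (.inr (.inl ⟨isCore_grotzschGraph hf, ⟨⟨fun x => clebschVertex (p x),
    fun x y hxy => ?_⟩, fun x y => ?_⟩,
    chromaticNumber_eq_four hG hp fun x y hxy => (hadj x y hxy).2⟩))
  · by_contra hne
    exact (hadj x y hne).1 (clebschVertex_injOn _ (hp x) _ (hp y) hxy)
  · rcases eq_or_ne x y with rfl | hxy
    · simp
    · exact (adj_clebschVertex _ (hp x) _ (hp y)).trans (hadj x y hxy).2.symm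
end

section
/- The Grötzsch graph F1 is not perfectly divisible; that is, there is no partition of the vertex set of F1 into sets A and B such that F1[A] is perfect and ω(F1[B]) < ω(F1) = 2. -/
open SimpleGraph

instance : DecidableRel GrotzschGraph.Adj := fun a b =>
  decidable_of_iff (s(a, b) ∈ ({s(0,1), s(0,2), s(0,3), s(0,4), s(0,5),
     s(6,7), s(7,8), s(8,9), s(9,10), s(6,10),
     s(1,6), s(1,8), s(2,7), s(2,9), s(3,8), s(3,10), s(4,9), s(4,6), s(5,10), s(5,7)} :
     Finset (Sym2 (Fin 11))) ∧ a ≠ b) (by simp [GrotzschGraph])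

theorem GrotzschGraph_cliqueFree_three : GrotzschGraph.CliqueFree 3 := by
  intro s hs
  obtain ⟨a, b, c, hab, hac, hbc, -⟩ := is3Clique_iff.mp hs
  have triangle_free : ∀ a b c : Fin 11, GrotzschGraph.Adj a b → GrotzschGraph.Adj a c →
      ¬ GrotzschGraph.Adj b c := by
    decide +kernel
  exact triangle_free a b c hab hac hbc

theorem GrotzschGraph_not_colorable_three : ¬ GrotzschGraph.Colorable 3 := by
  rintro ⟨c⟩
  have edge : ∀ {a b : Fin 11}, GrotzschGraph.Adj a b → c a ≠ c b := c.valid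
  have hcycle : ∀ k a b c d e : Fin 3, a ≠ k → b ≠ k → c ≠ k → d ≠ k → e ≠ k →
      a ≠ b → b ≠ c → c ≠ d → d ≠ e → a = e := by
    omega
  let d (w u : Fin 11) : Fin 3 := if c u = c 0 then c w else c u
  have hd : ∀ w u, GrotzschGraph.Adj 0 w → d w u ≠ c 0 := by
    intro w u hw
    have := edge hw
    grind
  have hdd : ∀ w u w' u', GrotzschGraph.Adj u u' → GrotzschGraph.Adj w u' →
      GrotzschGraph.Adj u w' → d w u ≠ d w' u' := by
    intro w u w' u' h₁ h₂ h₃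
    have := edge h₁
    have := edge h₂
    have := edge h₃
    grind
  refine hdd 5 6 4 10 ?_ ?_ ?_ (hcycle (c 0) (d 5 6) (d 1 7) (d 2 8) (d 3 9) (d 4 10)
    (hd _ _ ?_) (hd _ _ ?_) (hd _ _ ?_) (hd _ _ ?_) (hd _ _ ?_)
    (hdd _ _ _ _ ?_ ?_ ?_) (hdd _ _ _ _ ?_ ?_ ?_)
    (hdd _ _ _ _ ?_ ?_ ?_) (hdd _ _ _ _ ?_ ?_ ?_))
  all_goals simp [GrotzschGraph]

theorem cliqueNum_lt_iff_cliqueFree {V : Type*} [Finite V] {G : SimpleGraph V} {n : ℕ} :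
    G.cliqueNum < n ↔ G.CliqueFree n := by
  refine ⟨fun h s hs => ?_, fun h => ?_⟩
  · have := hs.isClique.card_le_cliqueNum
    have := hs.card_eq
    omega
  · obtain ⟨s, hs⟩ := G.exists_isNClique_cliqueNum
    by_contra! hn
    exact h.mono hn s hs

theorem GrotzschGraph_cliqueNum : GrotzschGraph.cliqueNum = 2 := by
  have h3 := cliqueNum_lt_iff_cliqueFree.mpr GrotzschGraph_cliqueFree_three
  have h2 : ¬ GrotzschGraph.cliqueNum < 2 := by
    rw [cliqueNum_lt_iff_cliqueFree, cliqueFree_two]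
    intro h
    have : GrotzschGraph.Adj 0 1 := by simp [GrotzschGraph]
    simp [h] at this
  omega

/-- A perfect graph without a clique of size `n + 1` is `n`-colorable. -/
theorem SimpleGraph.IsPerfect.colorable {V : Type*} [Finite V] {G : SimpleGraph V}
    (hG : G.IsPerfect) {n : ℕ} (hn : G.CliqueFree (n + 1)) : G.Colorable n := by
  have h := cliqueNum_lt_iff_cliqueFree.mpr (hn.comap ⟨(Embedding.induce Set.univ).toCopy⟩)
  have hc : (G.induce Set.univ).Colorable n := by
    rw [← chromaticNumber_le_iff_colorable, hG Set.univ]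
    exact_mod_cast Nat.lt_succ_iff.mp h
  exact hc.of_hom (induceUnivIso G).symm.toHom

theorem colorable_add_one_of_compl_independent {V : Type*} {G : SimpleGraph V} {A B : Set V}
    (hAB : A ∪ B = Set.univ) {n : ℕ} (hA : (G.induce A).Colorable n)
    (hB : (G.induce B).CliqueFree 2) : G.Colorable (n + 1) := by
  classical
  obtain ⟨c⟩ := hA
  refine ⟨Coloring.mk (fun v => if h : v ∈ A then (c ⟨v, h⟩).castSucc else Fin.last n) ?_⟩
  intro u v huv
  have hmem : ∀ w, w ∉ A → w ∈ B := fun w hw =>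
    (hAB ▸ Set.mem_univ w : w ∈ A ∪ B).resolve_left hw
  by_cases hu : u ∈ A <;> by_cases hv : v ∈ A
  · have := c.valid (show (G.induce A).Adj ⟨u, hu⟩ ⟨v, hv⟩ from huv)
    simpa [hu, hv] using this
  · simp [hu, hv, Fin.castSucc_ne_last]
  · simp [hu, hv, (Fin.castSucc_ne_last _).symm]
  · have : (G.induce B).Adj ⟨u, hmem u hu⟩ ⟨v, hmem v hv⟩ := huv
    rw [cliqueFree_two] at hB
    simp [hB] at this

theorem statement_10 :
    GrotzschGraph.cliqueNum = 2 ∧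
    ¬ ∃ A B : Set (Fin 11), A ∪ B = Set.univ ∧ A ∩ B = ∅ ∧
      (GrotzschGraph.induce A).IsPerfect ∧
      (GrotzschGraph.induce B).cliqueNum < GrotzschGraph.cliqueNum := by
  refine ⟨GrotzschGraph_cliqueNum, ?_⟩
  rintro ⟨A, B, hAB, -, hA, hB⟩
  rw [GrotzschGraph_cliqueNum, cliqueNum_lt_iff_cliqueFree] at hB
  exact GrotzschGraph_not_colorable_three <| colorable_add_one_of_compl_independent hAB
    (hA.colorable (GrotzschGraph_cliqueFree_three.comap ⟨(Embedding.induce A).toCopy⟩)) hB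
end

section
/- Every perfectly divisible simple graph G satisfies χ(G) ≤ ω(G)(ω(G)+1)/2, i.e., χ(G) ≤ C(ω(G)+1, 2). -/
open SimpleGraph

namespace SimpleGraph

theorem Embedding.cliqueNum_le {α β : Type*} [Finite β] {G : SimpleGraph α} {H : SimpleGraph β}
    (f : G ↪g H) : G.cliqueNum ≤ H.cliqueNum := by
  obtain ⟨s, hs⟩ := G.exists_isNClique_cliqueNum
  have ht : H.IsNClique G.cliqueNum (s.map f.toEmbedding) :=
    (hs.map (f := f.toEmbedding)).mono ((map_le_iff_le_comap _ _ _).2 f.comap_eq.ge)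
  exact ht.card_eq ▸ ht.isClique.card_le_cliqueNum

theorem cliqueNum_induce_mono {V : Type*} [Finite V] (G : SimpleGraph V) {s t : Set V}
    (hst : s ⊆ t) : (G.induce s).cliqueNum ≤ (G.induce t).cliqueNum :=
  (induceHomOfLE G hst).cliqueNum_le

theorem IsPerfect.colorable_cliqueNum {V : Type*} [Finite V] {G : SimpleGraph V}
    (hG : G.IsPerfect) : G.Colorable G.cliqueNum :=
  ((chromaticNumber_le_iff_colorable.1 (hG Set.univ).le).mono
    (cliqueNum_induce_le Set.univ)).of_hom (induceUnivIso G).symm.toHom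

theorem Colorable.induce_union {V : Type*} {G : SimpleGraph V} {s t : Set V} {m n : ℕ}
    (hs : (G.induce s).Colorable m) (ht : (G.induce t).Colorable n) :
    (G.induce (s ∪ t)).Colorable (m + n) := by
  classical
  obtain ⟨c⟩ := hs
  obtain ⟨d⟩ := ht
  let e : (G.induce (s ∪ t)).Coloring (Fin m ⊕ Fin n) := Coloring.mk
    (fun v ↦ if h : v.1 ∈ s then .inl (c ⟨v, h⟩) else .inr (d ⟨v, v.2.resolve_left h⟩)) <| by
      intro v w hvw
      split_ifs with hv hw hw
      · exact fun h ↦ c.valid (v := ⟨v, hv⟩) (w := ⟨w, hw⟩) hvw (Sum.inl_injective h)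
      · exact Sum.inl_ne_inr
      · exact Sum.inr_ne_inl
      · exact fun h ↦ d.valid (v := ⟨v, v.2.resolve_left hv⟩)
          (w := ⟨w, w.2.resolve_left hw⟩) hvw (Sum.inr_injective h)
  simpa using e.colorable

theorem PerfectlyDivisible.colorable_induce {V : Type*} [Finite V] {G : SimpleGraph V}
    (h : G.PerfectlyDivisible) (n : ℕ) (s : Set V) (hs : (G.induce s).cliqueNum ≤ n) :
    (G.induce s).Colorable (n * (n + 1) / 2) := by
  induction n generalizing s with
  | zero =>
    obtain rfl | hne := s.eq_empty_or_nonempty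
    · exact .of_isEmpty _
    · obtain ⟨_, _, _, _, _, hB⟩ := h s hne
      omega
  | succ n ih =>
    obtain rfl | hne := s.eq_empty_or_nonempty
    · exact .of_isEmpty _
    obtain ⟨A, B, rfl, -, hA, hB⟩ := h s hne
    have hcA : (G.induce A).Colorable (n + 1) :=
      hA.colorable_cliqueNum.mono ((G.cliqueNum_induce_mono Set.subset_union_left).trans hs)
    refine (hcA.induce_union (ih B (by omega))).mono (le_of_eq ?_)
    rw [show (n + 1) * (n + 1 + 1) = n * (n + 1) + 2 * (n + 1) by ring]
    omega

end SimpleGraph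

theorem statement_11 {V : Type*} [Fintype V] (G : SimpleGraph V)
    (h : G.PerfectlyDivisible) :
    G.chromaticNumber ≤ ((G.cliqueNum * (G.cliqueNum + 1) / 2 : ℕ) : ℕ∞) := by
  exact chromaticNumber_le_iff_colorable.2 <|
    (h.colorable_induce _ Set.univ (cliqueNum_induce_le Set.univ)).of_hom
      (induceUnivIso G).symm.toHom
end
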